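/- arXiv:2001.10401 — 3 statements merged into one kernel-verified Lean document; each statement's English description precedes it below -/
import Mathlib

section
/- Fix n ∈ ℕ and an integer k with k > (n+1)/2. For a smooth function u on (0,1) × ℝⁿ define ‖u‖²_{H₀ᵏ} = Σ_{i + |α| ≤ k} ∫₀¹ ∫_{ℝⁿ} |(τ∂_τ)ⁱ (τ∂_x)^α u(τ,x)|² τ^(−(n+1)) dx dτ, where the sum is over i ∈ ℕ and multi-indices α ∈ ℕⁿ with i + |α| ≤ k, and (τ∂_x)^α = τ^{|α|} ∂_x^α. Then there exists a constant C > 0 such that for all smooth u, v on (0,1) × ℝⁿ with ‖u‖_{H₀ᵏ} < ∞ and ‖v‖_{H₀ᵏ} < ∞, one has ‖uv‖_{H₀ᵏ} ≤ C · ‖u‖_{H₀ᵏ} · ‖v‖_{H₀ᵏ}. -/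
open MeasureTheory
open scoped ENNReal

/-- The 0-vector field `τ ∂_τ` acting on functions on `ℝ_τ × ℝⁿ_x`. -/
noncomputable def tauDtau (n : ℕ) (u : ℝ × (Fin n → ℝ) → ℝ) :
    ℝ × (Fin n → ℝ) → ℝ :=
  fun p => p.1 * fderiv ℝ u p (1, 0)

/-- The coordinate vector field `∂_{x_j}`. -/
noncomputable def Dxj (n : ℕ) (j : Fin n) (u : ℝ × (Fin n → ℝ) → ℝ) :
    ℝ × (Fin n → ℝ) → ℝ :=
  fun p => fderiv ℝ u p (0, Pi.single j 1)

/-- The iterated spatial derivative `∂_x^α` for a multi-index `α ∈ ℕⁿ`. -/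
noncomputable def DxAlpha (n : ℕ) (α : Fin n → ℕ) :
    (ℝ × (Fin n → ℝ) → ℝ) → (ℝ × (Fin n → ℝ) → ℝ) :=
  (List.finRange n).foldr (fun j F => (Dxj n j)^[α j] ∘ F) id

/-- The 0-derivative `(τ∂_τ)ⁱ (τ∂_x)^α u`, where `(τ∂_x)^α = τ^{|α|} ∂_x^α`. -/
noncomputable def zeroDeriv (n : ℕ) (i : ℕ) (α : Fin n → ℕ)
    (u : ℝ × (Fin n → ℝ) → ℝ) : ℝ × (Fin n → ℝ) → ℝ :=
  (tauDtau n)^[i] fun p => p.1 ^ (∑ j, α j) * DxAlpha n α u p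

/-- The finite set of pairs `(i, α)` with `i + |α| ≤ k`. -/
def zeroIndex (n k : ℕ) : Finset (ℕ × (Fin n → ℕ)) :=
  (Finset.range (k + 1) ×ˢ Fintype.piFinset fun _ => Finset.range (k + 1)).filter
    fun q => q.1 + ∑ j, q.2 j ≤ k

/-- The squared 0-Sobolev norm of order `k` on `(0,1)_τ × ℝⁿ_x`:
`‖u‖²_{H₀ᵏ} = Σ_{i+|α|≤k} ∫ |(τ∂_τ)ⁱ(τ∂_x)^α u|² τ^{-(n+1)} dx dτ`. -/
noncomputable def zeroSobNormSq (n k : ℕ) (u : ℝ × (Fin n → ℝ) → ℝ) : ℝ≥0∞ :=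
  ∑ q ∈ zeroIndex n k,
    ∫⁻ p in Set.Ioo (0 : ℝ) 1 ×ˢ (Set.univ : Set (Fin n → ℝ)),
      ENNReal.ofReal ((zeroDeriv n q.1 q.2 u p) ^ 2 * p.1 ^ (-(n + 1 : ℤ)))

/-- The 0-Sobolev norm of order `k`. -/
noncomputable def zeroSobNorm (n k : ℕ) (u : ℝ × (Fin n → ℝ) → ℝ) : ℝ≥0∞ :=
  zeroSobNormSq n k u ^ (1 / 2 : ℝ)

open Set Metric
open scoped NNReal

/-- The model space `(0,1)_τ × ℝⁿ_x`. -/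
def zeroDomain (n : ℕ) : Set (ℝ × (Fin n → ℝ)) := Ioo (0 : ℝ) 1 ×ˢ univ

/-- The measure `τ^{-(n+1)} dτ dx` on `(0,1)_τ × ℝⁿ_x`. -/
noncomputable def zeroMeasure (n : ℕ) : Measure (ℝ × (Fin n → ℝ)) :=
  (volume.restrict (zeroDomain n)).withDensity fun p => ENNReal.ofReal (p.1 ^ (-(n + 1 : ℤ)))

theorem isOpen_zeroDomain (n : ℕ) : IsOpen (zeroDomain n) := isOpen_Ioo.prod isOpen_univ

theorem measurableSet_zeroDomain (n : ℕ) : MeasurableSet (zeroDomain n) :=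
  (isOpen_zeroDomain n).measurableSet

theorem mem_zeroDomain {n : ℕ} {z : ℝ × (Fin n → ℝ)} :
    z ∈ zeroDomain n ↔ 0 < z.1 ∧ z.1 < 1 := by
  simp [zeroDomain]

theorem measurable_zeroDensity (n : ℕ) :
    Measurable fun p : ℝ × (Fin n → ℝ) => ENNReal.ofReal (p.1 ^ (-(n + 1 : ℤ))) := by
  fun_prop

instance instSFiniteZeroMeasure (n : ℕ) : SFinite (zeroMeasure n) := by
  unfold zeroMeasure; infer_instance

theorem ae_zeroMeasure_mem (n : ℕ) : ∀ᵐ z ∂zeroMeasure n, z ∈ zeroDomain n :=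
  (withDensity_absolutelyContinuous _ _).ae_le (ae_restrict_mem (measurableSet_zeroDomain n))

/-- The integrand of `∫ g τ^{-(n+1)} dτ dx`, extended by zero. -/
noncomputable def zeroIntegrand (n : ℕ) (g : ℝ × (Fin n → ℝ) → ℝ≥0∞) :
    ℝ × (Fin n → ℝ) → ℝ≥0∞ :=
  (zeroDomain n).indicator fun p => ENNReal.ofReal (p.1 ^ (-(n + 1 : ℤ))) * g p

theorem measurable_zeroIntegrand {n : ℕ} {g : ℝ × (Fin n → ℝ) → ℝ≥0∞} (hg : Measurable g) :
    Measurable (zeroIntegrand n g) :=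
  ((measurable_zeroDensity n).mul hg).indicator (measurableSet_zeroDomain n)

theorem lintegral_zeroMeasure {n : ℕ} {g : ℝ × (Fin n → ℝ) → ℝ≥0∞} (hg : Measurable g) :
    ∫⁻ z, g z ∂zeroMeasure n = ∫⁻ z, zeroIntegrand n g z := by
  rw [zeroMeasure, lintegral_withDensity_eq_lintegral_mul _ (measurable_zeroDensity n) hg]
  exact (lintegral_indicator (measurableSet_zeroDomain n) _).symm

theorem lintegral_comp_smul_addHaar {E : Type*} [NormedAddCommGroup E] [NormedSpace ℝ E]
    [MeasurableSpace E] [BorelSpace E] [FiniteDimensional ℝ E] (μ : Measure E)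
    [μ.IsAddHaarMeasure] {f : E → ℝ≥0∞} (hf : Measurable f) {r : ℝ} (hr : 0 < r) :
    ∫⁻ x, f (r • x) ∂μ = ENNReal.ofReal (r ^ Module.finrank ℝ E)⁻¹ * ∫⁻ x, f x ∂μ := by
  rw [← lintegral_map hf (measurable_const_smul r), Measure.map_addHaar_smul μ hr.ne',
    lintegral_smul_measure, abs_of_nonneg (by positivity), smul_eq_mul]

/-- Increments, in the frame `(τ∂_τ, τ∂_x)`, over which functions are averaged. -/
def incrementBox (n : ℕ) : Set (ℝ × (Fin n → ℝ)) := Ioo (-(1 / 2) : ℝ) 0 ×ˢ ball 0 1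

theorem volume_incrementBox_ne_zero (n : ℕ) : volume (incrementBox n) ≠ 0 :=
  (IsOpen.measure_pos volume (isOpen_Ioo.prod isOpen_ball)
    ((nonempty_Ioo.2 (by norm_num)).prod (nonempty_ball.2 one_pos))).ne'

theorem volume_incrementBox_ne_top (n : ℕ) : volume (incrementBox n) ≠ ⊤ :=
  ((isBounded_Ioo _ _).prod isBounded_ball).measure_lt_top.ne

theorem measurableSet_incrementBox (n : ℕ) : MeasurableSet (incrementBox n) :=
  measurableSet_Ioo.prod measurableSet_ball

/-- The uniform probability measure on `incrementBox n`. -/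
noncomputable def incrementMeasure (n : ℕ) : Measure (ℝ × (Fin n → ℝ)) :=
  (volume (incrementBox n))⁻¹ • volume.restrict (incrementBox n)

instance instIsProbabilityMeasureIncrement (n : ℕ) :
    IsProbabilityMeasure (incrementMeasure n) :=
  ⟨by simp [incrementMeasure, ENNReal.inv_mul_cancel (volume_incrementBox_ne_zero n)
    (volume_incrementBox_ne_top n)]⟩

theorem ae_incrementMeasure_mem (n : ℕ) : ∀ᵐ y ∂incrementMeasure n, y ∈ incrementBox n :=
  Measure.ae_smul_measure (ae_restrict_mem (measurableSet_incrementBox n)) _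

theorem zeroDomain_add_smul_mem {n : ℕ} {z y : ℝ × (Fin n → ℝ)} (hz : z ∈ zeroDomain n)
    (hy : y ∈ incrementBox n) {t : ℝ} (ht0 : 0 ≤ t) (ht1 : t ≤ 1) :
    z + (t * z.1) • y ∈ zeroDomain n ∧ z.1 / 2 ≤ (z + (t * z.1) • y).1 ∧
      (z + (t * z.1) • y).1 ≤ z.1 := by
  rw [mem_zeroDomain] at hz
  obtain ⟨⟨h1, h2⟩, -⟩ := hy
  have h3 : (z + (t * z.1) • y).1 = z.1 + t * z.1 * y.1 := by simp
  have h4 : 0 ≤ t * z.1 := mul_nonneg ht0 hz.1.le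
  have h5 : t * z.1 ≤ z.1 := by nlinarith
  rw [mem_zeroDomain, h3]
  refine ⟨⟨?_, ?_⟩, ?_, ?_⟩ <;> nlinarith

/-- The average of `g` over a box of relative size `t` next to `z`. -/
noncomputable def zeroAverage (n : ℕ) (t : ℝ) (g : ℝ × (Fin n → ℝ) → ℝ≥0∞)
    (z : ℝ × (Fin n → ℝ)) : ℝ≥0∞ :=
  ∫⁻ y, g (z + (t * z.1) • y) ∂incrementMeasure n

theorem zeroAverage_le {n : ℕ} {g : ℝ × (Fin n → ℝ) → ℝ≥0∞} (hg : Measurable g) {t : ℝ}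
    (ht0 : 0 < t) (ht1 : t ≤ 1) {z : ℝ × (Fin n → ℝ)} (hz : z ∈ zeroDomain n) :
    zeroAverage n t g z ≤ (volume (incrementBox n))⁻¹ *
      (ENNReal.ofReal (t ^ (n + 1))⁻¹ * ∫⁻ w, g w ∂zeroMeasure n) := by
  have hz' := mem_zeroDomain.1 hz
  have htz : 0 < t * z.1 := mul_pos ht0 hz'.1
  rw [zeroAverage, incrementMeasure, lintegral_smul_measure, smul_eq_mul]
  gcongr
  calc ∫⁻ y in incrementBox n, g (z + (t * z.1) • y)
      ≤ ∫⁻ y in incrementBox n, ENNReal.ofReal (z.1 ^ (n + 1)) *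
          zeroIntegrand n g (z + (t * z.1) • y) := by
        refine setLIntegral_mono' (measurableSet_incrementBox n) fun y hy => ?_
        obtain ⟨hw, h1, h2⟩ := zeroDomain_add_smul_mem hz hy ht0.le ht1
        have hw0 := (mem_zeroDomain.1 hw).1
        rw [zeroIntegrand, indicator_of_mem hw, ← mul_assoc,
          ← ENNReal.ofReal_mul (by have := hz'.1; positivity)]
        refine le_mul_of_one_le_left' ?_
        rw [ENNReal.one_le_ofReal, zpow_neg, ← div_eq_mul_inv, one_le_div (by positivity)]
        exact_mod_cast pow_le_pow_left₀ hw0.le h2 (n + 1)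
    _ ≤ ∫⁻ y, ENNReal.ofReal (z.1 ^ (n + 1)) * zeroIntegrand n g (z + (t * z.1) • y) :=
        setLIntegral_le_lintegral _ _
    _ = ENNReal.ofReal (t ^ (n + 1))⁻¹ * ∫⁻ w, g w ∂zeroMeasure n := by
        have hm := measurable_zeroIntegrand hg
        have : (volume : Measure (ℝ × (Fin n → ℝ))).IsAddHaarMeasure :=
          inferInstanceAs ((volume : Measure ℝ).prod volume).IsAddHaarMeasure
        rw [lintegral_const_mul _ (by fun_prop),
          lintegral_comp_smul_addHaar volume (f := fun w => zeroIntegrand n g (z + w))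
            (by fun_prop) htz, lintegral_add_left_eq_self, lintegral_zeroMeasure hg, ← mul_assoc,
          ← ENNReal.ofReal_mul (by have := hz'.1; positivity)]
        congr 2
        have : Module.finrank ℝ (ℝ × (Fin n → ℝ)) = n + 1 := by simp [add_comm]
        rw [this, mul_pow]
        have := hz'.1.ne'
        field_simp

theorem measurable_zeroAverage_uncurry {n : ℕ} {g : ℝ × (Fin n → ℝ) → ℝ≥0∞}
    (hg : Measurable g) :
    Measurable fun q : ℝ × (ℝ × (Fin n → ℝ)) => zeroAverage n q.1 g q.2 := by
  unfold zeroAverage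
  refine Measurable.lintegral_prod_right' (f := fun r : (ℝ × (ℝ × (Fin n → ℝ))) ×
    (ℝ × (Fin n → ℝ)) => g (r.1.2 + (r.1.1 * r.1.2.1) • r.2)) ?_
  fun_prop

theorem lintegral_zeroAverage_le {n : ℕ} {g : ℝ × (Fin n → ℝ) → ℝ≥0∞} (hg : Measurable g)
    {t : ℝ} (ht0 : 0 ≤ t) (ht1 : t ≤ 1) :
    ∫⁻ z, zeroAverage n t g z ∂zeroMeasure n ≤ 2 * ∫⁻ z, g z ∂zeroMeasure n := by
  unfold zeroAverage
  rw [lintegral_lintegral_swap (by fun_prop)]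
  refine (lintegral_mono_ae (g := fun _ => 2 * ∫⁻ z, g z ∂zeroMeasure n) ?_).trans (by simp)
  filter_upwards [ae_incrementMeasure_mem n] with y hy
  have hm := measurable_zeroIntegrand hg
  have hy1 : -(1 / 2) < y.1 ∧ y.1 < 0 := hy.1
  have hc : 1 / 2 ≤ 1 + t * y.1 := by nlinarith
  have hc1 : 1 + t * y.1 ≤ 1 := by nlinarith
  set c := 1 + t * y.1 with hc_def
  have hc0 : 0 < c := by linarith
  rw [lintegral_zeroMeasure (by fun_prop), lintegral_zeroMeasure hg]
  calc ∫⁻ z, zeroIntegrand n (fun z => g (z + (t * z.1) • y)) z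
      ≤ ∫⁻ z : ℝ × (Fin n → ℝ), zeroIntegrand n g (c • z.1, z.2 + (t * z.1) • y.2) := by
        refine lintegral_mono fun z => ?_
        by_cases hz : z ∈ zeroDomain n
        swap
        · simp [zeroIntegrand, hz]
        obtain ⟨hw, h1, h2⟩ := zeroDomain_add_smul_mem hz hy ht0 ht1
        have hw0 := (mem_zeroDomain.1 hw).1
        have hz0 := (mem_zeroDomain.1 hz).1
        have heq : (c • z.1, z.2 + (t * z.1) • y.2) = z + (t * z.1) • y := by
          ext1
          · simp [hc_def]; ring
          · simp
        rw [heq, zeroIntegrand, indicator_of_mem hz, zeroIntegrand, indicator_of_mem hw]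
        gcongr
        rw [zpow_neg, zpow_neg]
        gcongr
        exact_mod_cast pow_le_pow_left₀ hw0.le h2 (n + 1)
    _ = ∫⁻ τ, ∫⁻ x, zeroIntegrand n g (c • τ, x + (t * τ) • y.2) := by
        rw [Measure.volume_eq_prod, lintegral_prod _ (by fun_prop)]
    _ = ∫⁻ τ, ∫⁻ x, zeroIntegrand n g (c • τ, x) := by
        refine lintegral_congr fun τ => ?_
        exact lintegral_add_right_eq_self (fun x => zeroIntegrand n g (c • τ, x)) _
    _ = ENNReal.ofReal (c ^ 1)⁻¹ * ∫⁻ τ, ∫⁻ x, zeroIntegrand n g (τ, x) := by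
        rw [lintegral_comp_smul_addHaar volume
          (f := fun τ => ∫⁻ x, zeroIntegrand n g (τ, x)) hm.lintegral_prod_right' hc0]
        simp
    _ = ENNReal.ofReal (c ^ 1)⁻¹ * ∫⁻ z, zeroIntegrand n g z := by
        rw [Measure.volume_eq_prod, lintegral_prod _ (by fun_prop)]
    _ ≤ 2 * ∫⁻ z, zeroIntegrand n g z := by
        gcongr
        rw [pow_one, ← ENNReal.ofReal_ofNat]
        refine ENNReal.ofReal_le_ofReal ?_
        rw [inv_le_comm₀ hc0 two_pos]
        linarith

theorem lintegral_le_rpow_lintegral_rpow {α : Type*} [MeasurableSpace α] (μ : Measure α)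
    {f : α → ℝ≥0∞} (hf : Measurable f) {q : ℝ} (hq : 1 ≤ q) :
    ∫⁻ a, f a ∂μ ≤ (∫⁻ a, f a ^ q ∂μ) ^ (1 / q) * μ univ ^ (1 - 1 / q) := by
  have := eLpNorm'_le_eLpNorm'_mul_rpow_measure_univ (μ := μ) one_pos hq hf.aestronglyMeasurable
  simpa [eLpNorm'_eq_lintegral_enorm] using this

/-- The measure `t^{-κ} dt` on `(0,1)`. -/
noncomputable def powerMeasure (κ : ℝ) : Measure ℝ :=
  (volume.restrict (Ioo 0 1)).withDensity fun t => ENNReal.ofReal (t ^ (-κ))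

instance instSFinitePowerMeasure (κ : ℝ) : SFinite (powerMeasure κ) := by
  unfold powerMeasure; infer_instance

theorem powerMeasure_univ_ne_top {κ : ℝ} (hκ : κ < 1) : powerMeasure κ univ ≠ ⊤ := by
  have h := (intervalIntegral.intervalIntegrable_rpow' (a := 0) (b := 1) (r := -κ)
    (by linarith)).1
  rw [powerMeasure, withDensity_apply _ MeasurableSet.univ, Measure.restrict_univ]
  have h2 := h.mono_set Ioo_subset_Ioc_self
  exact h2.lintegral_lt_top.ne

/-- The average over `0 < t < 1` of the averages at relative scale `t`. -/
noncomputable def zeroPotential (n : ℕ) (g : ℝ × (Fin n → ℝ) → ℝ≥0∞)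
    (z : ℝ × (Fin n → ℝ)) : ℝ≥0∞ :=
  ∫⁻ t in Ioo (0 : ℝ) 1, zeroAverage n t g z

theorem zeroAverage_le_rpow {n : ℕ} {g : ℝ × (Fin n → ℝ) → ℝ≥0∞} (hg : Measurable g)
    {p r : ℝ} (hp : 1 ≤ p) (hr : 0 ≤ r) (hrp : r ≤ 1 / p) {t : ℝ} (ht0 : 0 < t) (ht1 : t ≤ 1)
    {z : ℝ × (Fin n → ℝ)} (hz : z ∈ zeroDomain n) :
    zeroAverage n t g z ≤ ((volume (incrementBox n))⁻¹ *
      ∫⁻ w, g w ^ p ∂zeroMeasure n) ^ (1 / p - r) *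
        (ENNReal.ofReal (t ^ (-((n + 1) * (1 / p - r)))) *
          zeroAverage n t (fun w => g w ^ p) z ^ r) := by
  have hδ : 0 ≤ 1 / p - r := by linarith
  have h1 : zeroAverage n t g z ≤ zeroAverage n t (fun w => g w ^ p) z ^ (1 / p) := by
    simpa [zeroAverage] using lintegral_le_rpow_lintegral_rpow (incrementMeasure n)
      (f := fun y => g (z + (t * z.1) • y)) (by fun_prop) hp
  have h2 := zeroAverage_le (g := fun w => g w ^ p) (by fun_prop) ht0 ht1 hz
  calc zeroAverage n t g z
      ≤ zeroAverage n t (fun w => g w ^ p) z ^ (1 / p - r) *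
          zeroAverage n t (fun w => g w ^ p) z ^ r := by
        rw [← ENNReal.rpow_add_of_nonneg _ _ hδ hr]
        simpa using h1
    _ ≤ ((volume (incrementBox n))⁻¹ * (ENNReal.ofReal (t ^ (n + 1))⁻¹ *
          ∫⁻ w, g w ^ p ∂zeroMeasure n)) ^ (1 / p - r) *
            zeroAverage n t (fun w => g w ^ p) z ^ r := by
        gcongr
    _ = _ := by
        have h3 : ENNReal.ofReal (t ^ (n + 1))⁻¹ ^ (1 / p - r) =
            ENNReal.ofReal (t ^ (-((n + 1) * (1 / p - r)))) := by
          rw [ENNReal.ofReal_rpow_of_pos (by positivity), ← Real.rpow_natCast,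
            ← Real.rpow_neg ht0.le, ← Real.rpow_mul ht0.le]
          push_cast
          ring_nf
        rw [← h3, ← mul_assoc, mul_left_comm, ENNReal.mul_rpow_of_nonneg _ _ hδ,
          ENNReal.mul_rpow_of_nonneg _ _ hδ, ENNReal.mul_rpow_of_nonneg _ _ hδ]
        ring

theorem zeroPotential_le_rpow {n : ℕ} {g : ℝ × (Fin n → ℝ) → ℝ≥0∞} (hg : Measurable g)
    {p r : ℝ} (hp : 1 ≤ p) (hr : 0 ≤ r) (hrp : r ≤ 1 / p)
    {z : ℝ × (Fin n → ℝ)} (hz : z ∈ zeroDomain n) :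
    zeroPotential n g z ≤ ((volume (incrementBox n))⁻¹ *
      ∫⁻ w, g w ^ p ∂zeroMeasure n) ^ (1 / p - r) *
        ∫⁻ t, zeroAverage n t (fun w => g w ^ p) z ^ r
          ∂powerMeasure ((n + 1) * (1 / p - r)) := by
  have hm : Measurable fun t => zeroAverage n t (fun w => g w ^ p) z ^ r :=
    ((measurable_zeroAverage_uncurry (g := fun w => g w ^ p) (by fun_prop)).comp
      measurable_prodMk_right).pow_const r
  rw [zeroPotential, powerMeasure, lintegral_withDensity_eq_lintegral_mul _ (by fun_prop) hm,
    ← lintegral_const_mul _ (by fun_prop)]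
  exact setLIntegral_mono' measurableSet_Ioo fun t ht =>
    zeroAverage_le_rpow hg hp hr hrp ht.1 ht.2.le hz

theorem eLpNorm_zeroPotential_le (n : ℕ) {p r : ℝ} (hp : 1 ≤ p) (hr : 0 ≤ r) (hrp : r ≤ 1 / p)
    (hlt : (n + 1) * (1 / p - r) < 1) :
    ∃ C : ℝ≥0, ∀ g : ℝ × (Fin n → ℝ) → ℝ≥0∞, Measurable g →
      eLpNorm (zeroPotential n g) (ENNReal.ofReal r)⁻¹ (zeroMeasure n) ≤
        C * eLpNorm g (ENNReal.ofReal p) (zeroMeasure n) := by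
  have hp0 : 0 < p := by linarith
  have hδ : 0 ≤ 1 / p - r := by linarith
  have hr1 : r ≤ 1 := hrp.trans ((div_le_one hp0).2 hp)
  set κ := (n + 1) * (1 / p - r) with hκ
  set M := powerMeasure κ univ with hM
  have hMtop : M ≠ ⊤ := powerMeasure_univ_ne_top hlt
  have hVtop : (volume (incrementBox n))⁻¹ ≠ ⊤ :=
    ENNReal.inv_ne_top.2 (volume_incrementBox_ne_zero n)
  set V := (volume (incrementBox n))⁻¹ with hV
  have hC : V ^ (1 / p - r) * M ^ (1 - r) * (2 * M) ^ r ≠ ⊤ :=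
    ENNReal.mul_ne_top (ENNReal.mul_ne_top (ENNReal.rpow_ne_top_of_nonneg hδ hVtop)
      (ENNReal.rpow_ne_top_of_nonneg (by linarith) hMtop))
      (ENNReal.rpow_ne_top_of_nonneg hr (ENNReal.mul_ne_top (by simp) hMtop))
  refine ⟨(V ^ (1 / p - r) * M ^ (1 - r) * (2 * M) ^ r).toNNReal, fun g hg => ?_⟩
  rw [ENNReal.coe_toNNReal hC]
  have hgp : eLpNorm g (ENNReal.ofReal p) (zeroMeasure n) =
      (∫⁻ w, g w ^ p ∂zeroMeasure n) ^ (1 / p) := by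
    rw [eLpNorm_eq_lintegral_rpow_enorm_toReal (by simpa using hp0) ENNReal.ofReal_ne_top]
    simp [ENNReal.toReal_ofReal hp0.le]
  rw [hgp]
  set I := ∫⁻ w, g w ^ p ∂zeroMeasure n with hI
  have hpt : ∀ z ∈ zeroDomain n, zeroPotential n g z ≤ (V * I) ^ (1 / p - r) *
      ∫⁻ t, zeroAverage n t (fun w => g w ^ p) z ^ r ∂powerMeasure κ :=
    fun z hz => zeroPotential_le_rpow hg hp hr hrp hz
  rcases hr.eq_or_lt with rfl | hr0
  · simp only [ENNReal.ofReal_zero, ENNReal.inv_zero, eLpNorm_exponent_top]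
    refine eLpNormEssSup_le_of_ae_enorm_bound ?_
    filter_upwards [ae_zeroMeasure_mem n] with z hz
    refine (hpt z hz).trans_eq ?_
    simp only [sub_zero, ENNReal.rpow_zero, lintegral_const, one_mul, mul_one, ENNReal.rpow_one]
    rw [ENNReal.mul_rpow_of_nonneg _ _ (by positivity)]
    ring
  · have hq : 1 ≤ 1 / r := (one_le_div hr0).2 hr1
    have hm : Measurable fun q : ℝ × (ℝ × (Fin n → ℝ)) =>
        zeroAverage n q.1 (fun w => g w ^ p) q.2 :=
      measurable_zeroAverage_uncurry (by fun_prop)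
    have hpt2 : ∀ z ∈ zeroDomain n, zeroPotential n g z ^ (1 / r) ≤
        ((V * I) ^ (1 / p - r) * M ^ (1 - r)) ^ (1 / r) *
          ∫⁻ t, zeroAverage n t (fun w => g w ^ p) z ∂powerMeasure κ := by
      intro z hz
      have h3 := lintegral_le_rpow_lintegral_rpow (powerMeasure κ)
        (f := fun t => zeroAverage n t (fun w => g w ^ p) z ^ r)
        ((hm.comp measurable_prodMk_right).pow_const r) hq
      simp only [one_div, inv_inv, ENNReal.rpow_rpow_inv hr0.ne'] at h3
      have h4 := (hpt z hz).trans (mul_le_mul_right h3 _)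
      refine (ENNReal.rpow_le_rpow h4 (by positivity)).trans_eq ?_
      rw [← hM, ← mul_assoc, mul_right_comm, ENNReal.mul_rpow_of_nonneg _ _ (by positivity),
        one_div r, ENNReal.rpow_rpow_inv hr0.ne']
    have hintegral : ∫⁻ z, ∫⁻ t, zeroAverage n t (fun w => g w ^ p) z ∂powerMeasure κ ∂zeroMeasure n
        ≤ 2 * M * I := by
      rw [lintegral_lintegral_swap (f := fun z t => zeroAverage n t (fun w => g w ^ p) z)
        (hm.comp measurable_swap).aemeasurable]
      refine (lintegral_mono_ae (g := fun _ => 2 * I) ?_).trans_eq ?_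
      · have : ∀ᵐ t ∂powerMeasure κ, t ∈ Ioo (0 : ℝ) 1 :=
          (withDensity_absolutelyContinuous _ _).ae_le (ae_restrict_mem measurableSet_Ioo)
        filter_upwards [this] with t ht
        exact lintegral_zeroAverage_le (by fun_prop) ht.1.le ht.2.le
      · rw [lintegral_const]; ring
    have hexp : (ENNReal.ofReal r)⁻¹ = ENNReal.ofReal (1 / r) := by
      rw [one_div, ENNReal.ofReal_inv_of_pos hr0]
    rw [hexp, eLpNorm_eq_lintegral_rpow_enorm_toReal (by simpa using hr0) ENNReal.ofReal_ne_top,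
      ENNReal.toReal_ofReal (by positivity)]
    simp only [enorm_eq_self]
    calc (∫⁻ z, zeroPotential n g z ^ (1 / r) ∂zeroMeasure n) ^ (1 / (1 / r))
        ≤ (((V * I) ^ (1 / p - r) * M ^ (1 - r)) ^ (1 / r) * (2 * M * I)) ^ (1 / (1 / r)) := by
          gcongr
          refine le_trans ?_ (mul_le_mul_right hintegral _)
          rw [← lintegral_const_mul _ hm.lintegral_prod_left']
          refine lintegral_mono_ae ?_
          filter_upwards [ae_zeroMeasure_mem n] with z hz using hpt2 z hz
      _ = (V * I) ^ (1 / p - r) * M ^ (1 - r) * (2 * M * I) ^ r := by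
          rw [one_div_one_div, ENNReal.mul_rpow_of_nonneg _ _ hr, one_div r,
            ENNReal.rpow_inv_rpow hr0.ne']
      _ = V ^ (1 / p - r) * M ^ (1 - r) * (2 * M) ^ r * (I ^ (1 / p - r) * I ^ r) := by
          rw [ENNReal.mul_rpow_of_nonneg _ _ hδ, ENNReal.mul_rpow_of_nonneg _ _ hr]
          ring
      _ = _ := by
          rw [← ENNReal.rpow_add_of_nonneg _ _ hδ hr, sub_add_cancel]

/-- The coordinate frame `∂_τ, ∂_{x_j}`. -/
noncomputable def coordFrame (n : ℕ) : Option (Fin n) → ℝ × (Fin n → ℝ)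
  | none => (1, 0)
  | some j => (0, Pi.single j 1)

/-- The 0-vector fields `τ∂_τ, τ∂_{x_j}`. -/
noncomputable def zeroField (n : ℕ) (c : Option (Fin n)) (f : ℝ × (Fin n → ℝ) → ℝ) :
    ℝ × (Fin n → ℝ) → ℝ :=
  fun p => p.1 * fderiv ℝ f p (coordFrame n c)

/-- Smoothness on the model space. -/
abbrev ZeroSmooth (n : ℕ) (f : ℝ × (Fin n → ℝ) → ℝ) : Prop :=
  ContDiffOn ℝ (⊤ : ℕ∞) f (zeroDomain n)

namespace ZeroSmooth

variable {n : ℕ} {f g : ℝ × (Fin n → ℝ) → ℝ}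

theorem contDiffAt (hf : ZeroSmooth n f) {z : ℝ × (Fin n → ℝ)} (hz : z ∈ zeroDomain n) :
    ContDiffAt ℝ (⊤ : ℕ∞) f z :=
  ContDiffOn.contDiffAt hf ((isOpen_zeroDomain n).mem_nhds hz)

theorem differentiableAt (hf : ZeroSmooth n f) {z : ℝ × (Fin n → ℝ)} (hz : z ∈ zeroDomain n) :
    DifferentiableAt ℝ f z :=
  (hf.contDiffAt hz).differentiableAt (by simp)

theorem fderiv_apply (hf : ZeroSmooth n f) (e : ℝ × (Fin n → ℝ)) :
    ZeroSmooth n fun p => fderiv ℝ f p e :=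
  (ContDiffOn.fderiv_of_isOpen hf (isOpen_zeroDomain n) (m := (⊤ : ℕ∞)) (by simp)).clm_apply
    contDiffOn_const

theorem zeroField (hf : ZeroSmooth n f) (c : Option (Fin n)) :
    ZeroSmooth n (zeroField n c f) :=
  contDiffOn_fst.mul (hf.fderiv_apply _)

theorem aestronglyMeasurable (hf : ZeroSmooth n f) : AEStronglyMeasurable f (zeroMeasure n) :=
  (ContDiffOn.continuousOn hf |>.aestronglyMeasurable (measurableSet_zeroDomain n)).mono_ac
    (withDensity_absolutelyContinuous _ _)

end ZeroSmooth

theorem abs_fderiv_apply_le {n : ℕ} (f : ℝ × (Fin n → ℝ) → ℝ) {y : ℝ × (Fin n → ℝ)}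
    (hy : y ∈ incrementBox n) (w : ℝ × (Fin n → ℝ)) :
    |fderiv ℝ f w y| ≤ ∑ c, |fderiv ℝ f w (coordFrame n c)| := by
  obtain ⟨⟨h1, h2⟩, h3⟩ := hy
  have hdec : y = y.1 • coordFrame n none + ∑ j, y.2 j • coordFrame n (some j) := by
    ext1
    · simp [coordFrame, Prod.fst_sum]
    · simp only [coordFrame, Prod.snd_add, Prod.snd_sum, Prod.smul_snd, smul_zero, zero_add]
      exact (pi_eq_sum_univ' y.2).trans (by simp)
  conv_lhs => rw [hdec]
  rw [map_add, map_sum, Fintype.sum_option]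
  simp only [map_smul, smul_eq_mul]
  refine (abs_add_le _ _).trans (add_le_add ?_ ((Finset.abs_sum_le_sum_abs _ _).trans
    (Finset.sum_le_sum fun j _ => ?_))) <;> rw [abs_mul]
  · exact mul_le_of_le_one_left (abs_nonneg _) (abs_le.2 ⟨by linarith, by linarith⟩)
  · refine mul_le_of_le_one_left (abs_nonneg _) ((norm_le_pi_norm y.2 j).trans ?_)
    exact (mem_ball_zero_iff.1 h3).le

/-- The pointwise size of `f` and its first 0-derivatives, extended by zero. -/
noncomputable def firstOrderSize (n : ℕ) (f : ℝ × (Fin n → ℝ) → ℝ) : ℝ × (Fin n → ℝ) → ℝ :=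
  (zeroDomain n).indicator fun w => |f w| + ∑ c, 2 * |zeroField n c f w|

theorem measurable_firstOrderSize {n : ℕ} {f : ℝ × (Fin n → ℝ) → ℝ} (hf : ZeroSmooth n f) :
    Measurable (firstOrderSize n f) := by
  classical
  rw [firstOrderSize, ← piecewise_eq_indicator]
  refine ContinuousOn.measurable_piecewise ?_ continuousOn_const (measurableSet_zeroDomain n)
  refine (ContDiffOn.continuousOn hf).abs.add (continuousOn_finsetSum _ fun c _ => ?_)
  exact (ContDiffOn.continuousOn (hf.zeroField c)).abs.const_mul 2

theorem enorm_le_lintegral_firstOrderSize {n : ℕ} {f : ℝ × (Fin n → ℝ) → ℝ}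
    (hf : ZeroSmooth n f) {z y : ℝ × (Fin n → ℝ)} (hz : z ∈ zeroDomain n)
    (hy : y ∈ incrementBox n) :
    ‖f z‖ₑ ≤ ∫⁻ t in Ioo (0 : ℝ) 1, ‖firstOrderSize n f (z + (t * z.1) • y)‖ₑ := by
  have hmem : ∀ t ∈ Icc (0 : ℝ) 1, z + (t * z.1) • y ∈ zeroDomain n := fun t ht =>
    (zeroDomain_add_smul_mem hz hy ht.1 ht.2).1
  have hpath : ∀ t : ℝ, HasDerivAt (fun t : ℝ => z + (t * z.1) • y) (z.1 • y) t := fun t => by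
    simpa using (((hasDerivAt_id t).mul_const z.1).smul_const y).const_add z
  set S : ℝ → ℝ := fun t => ∑ c, 2 * |zeroField n c f (z + (t * z.1) • y)| with hS
  have hS0 : ∀ t, 0 ≤ S t := fun t => Finset.sum_nonneg fun c _ => by positivity
  have hpathC : ContDiff ℝ 1 fun t : ℝ => z + (t * z.1) • y := by fun_prop
  have hderiv : ∀ t ∈ Icc (0 : ℝ) 1,
      ‖deriv (fun t : ℝ => f (z + (t * z.1) • y)) t‖ₑ ≤ ‖S t‖ₑ := by
    intro t ht
    obtain ⟨hw, hw1, -⟩ := zeroDomain_add_smul_mem hz hy ht.1 ht.2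
    have hz0 := (mem_zeroDomain.1 hz).1
    have hw0 := (mem_zeroDomain.1 hw).1
    have h := ((hf.differentiableAt hw).hasFDerivAt.comp_hasDerivAt t (hpath t)).deriv
    simp only [Function.comp_def] at h
    rw [h, enorm_le_iff_norm_le, Real.norm_eq_abs, Real.norm_eq_abs, abs_of_nonneg (hS0 t),
      map_smul, smul_eq_mul, abs_mul, abs_of_pos hz0]
    calc z.1 * |fderiv ℝ f (z + (t * z.1) • y) y|
        ≤ (2 * (z + (t * z.1) • y).1) *
            ∑ c, |fderiv ℝ f (z + (t * z.1) • y) (coordFrame n c)| :=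
          mul_le_mul (by linarith) (abs_fderiv_apply_le f hy _) (abs_nonneg _) (by positivity)
      _ = S t := by
          rw [hS, Finset.mul_sum]
          refine Finset.sum_congr rfl fun c _ => ?_
          rw [_root_.zeroField, abs_mul, abs_of_pos hw0, mul_assoc]
  have hpt : ∀ s ∈ Ioo (0 : ℝ) 1,
      ‖f z‖ₑ ≤ ‖f (z + (s * z.1) • y)‖ₑ + ∫⁻ t in Ioo (0 : ℝ) 1, ‖S t‖ₑ := by
    intro s hs
    have hC : ContDiffOn ℝ 1 (fun t : ℝ => f (z + (t * z.1) • y)) (Icc 0 s) :=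
      (hf.of_le (by simp)).comp hpathC.contDiffOn fun t ht => hmem t ⟨ht.1, ht.2.trans hs.2.le⟩
    have h1 := enorm_sub_le_lintegral_deriv_of_contDiffOn_Icc hC hs.1.le
    simp only [zero_mul, zero_smul, add_zero] at h1
    have h2 : ∫⁻ t in Icc 0 s, ‖deriv (fun t : ℝ => f (z + (t * z.1) • y)) t‖ₑ ≤
        ∫⁻ t in Ioo (0 : ℝ) 1, ‖S t‖ₑ := by
      rw [restrict_Ioo_eq_restrict_Icc]
      exact (lintegral_mono_set (Icc_subset_Icc_right hs.2.le)).trans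
        (setLIntegral_mono' measurableSet_Icc hderiv)
    calc ‖f z‖ₑ = ‖f (z + (s * z.1) • y) - (f (z + (s * z.1) • y) - f z)‖ₑ := by
          rw [sub_sub_cancel]
      _ ≤ _ := enorm_sub_le.trans (add_le_add le_rfl (h1.trans h2))
  have hScont : ContinuousOn S (Icc 0 1) :=
    continuousOn_finsetSum _ fun c _ =>
      (((ContDiffOn.continuousOn (hf.zeroField c)).comp hpathC.continuous.continuousOn
        hmem).abs.const_mul 2)
  have hfcont : ContinuousOn (fun t : ℝ => f (z + (t * z.1) • y)) (Icc 0 1) :=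
    (ContDiffOn.continuousOn hf).comp hpathC.continuous.continuousOn hmem
  calc ‖f z‖ₑ = ∫⁻ _ in Ioo (0 : ℝ) 1, ‖f z‖ₑ := by simp
    _ ≤ ∫⁻ s in Ioo (0 : ℝ) 1,
          (‖f (z + (s * z.1) • y)‖ₑ + ∫⁻ t in Ioo (0 : ℝ) 1, ‖S t‖ₑ) :=
        setLIntegral_mono' measurableSet_Ioo hpt
    _ = ∫⁻ s in Ioo (0 : ℝ) 1, (‖f (z + (s * z.1) • y)‖ₑ + ‖S s‖ₑ) := by
        rw [lintegral_add_right _ measurable_const, lintegral_add_right' _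
          ((hScont.mono Ioo_subset_Icc_self).aemeasurable measurableSet_Ioo).enorm]
        simp
    _ = _ := by
        refine setLIntegral_congr_fun measurableSet_Ioo fun t ht => ?_
        have hw := hmem t ⟨ht.1.le, ht.2.le⟩
        simp only [firstOrderSize, indicator_of_mem hw]
        rw [Real.enorm_eq_ofReal (add_nonneg (abs_nonneg _) (hS0 t)),
          ENNReal.ofReal_add (abs_nonneg _) (hS0 t), Real.enorm_eq_ofReal_abs,
          Real.enorm_eq_ofReal (hS0 t)]

theorem enorm_le_zeroPotential {n : ℕ} {f : ℝ × (Fin n → ℝ) → ℝ} (hf : ZeroSmooth n f)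
    {z : ℝ × (Fin n → ℝ)} (hz : z ∈ zeroDomain n) :
    ‖f z‖ₑ ≤ zeroPotential n (fun w => ‖firstOrderSize n f w‖ₑ) z := by
  have hm := measurable_firstOrderSize hf
  unfold zeroPotential zeroAverage
  rw [lintegral_lintegral_swap (by fun_prop)]
  calc ‖f z‖ₑ = ∫⁻ _, ‖f z‖ₑ ∂incrementMeasure n := by simp
    _ ≤ _ := lintegral_mono_ae <| by
        filter_upwards [ae_incrementMeasure_mem n] with y hy
        exact enorm_le_lintegral_firstOrderSize hf hz hy

theorem eLpNorm_firstOrderSize_le {n : ℕ} {f : ℝ × (Fin n → ℝ) → ℝ} (hf : ZeroSmooth n f)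
    {p : ℝ≥0∞} (hp : 1 ≤ p) :
    eLpNorm (firstOrderSize n f) p (zeroMeasure n) ≤
      2 * (eLpNorm f p (zeroMeasure n) + ∑ c, eLpNorm (zeroField n c f) p (zeroMeasure n)) := by
  have hae : firstOrderSize n f =ᵐ[zeroMeasure n]
      (fun w => |f w|) + ∑ c, (2 : ℝ) • fun w => |zeroField n c f w| := by
    filter_upwards [ae_zeroMeasure_mem n] with w hw
    simp [firstOrderSize, hw]
  have habs : ∀ g : ℝ × (Fin n → ℝ) → ℝ,
      eLpNorm (fun w => |g w|) p (zeroMeasure n) = eLpNorm g p (zeroMeasure n) :=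
    fun g => eLpNorm_norm g
  rw [eLpNorm_congr_ae hae, mul_add, Finset.mul_sum]
  have hmeas : ∀ c, AEStronglyMeasurable ((2 : ℝ) • fun w => |zeroField n c f w|)
      (zeroMeasure n) := fun c => (hf.zeroField c).aestronglyMeasurable.norm.const_smul 2
  refine (eLpNorm_add_le hf.aestronglyMeasurable.norm
    (Finset.aestronglyMeasurable_sum _ fun c _ => hmeas c) hp).trans (add_le_add ?_ ?_)
  · rw [eLpNorm_norm]
    exact le_mul_of_one_le_left' (by norm_num)
  · refine (eLpNorm_sum_le (fun c _ => hmeas c) hp).trans (Finset.sum_le_sum fun c _ => ?_)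
    rw [eLpNorm_const_smul, habs]
    simp [Real.enorm_eq_ofReal_abs]

theorem eLpNorm_le_eLpNorm_zeroField (n : ℕ) {r s : ℝ} (hr : 0 ≤ r) (hrs : r ≤ s) (hs0 : 0 < s)
    (hs1 : s ≤ 1) (hlt : (n + 1) * (s - r) < 1) :
    ∃ C : ℝ≥0, ∀ f, ZeroSmooth n f →
      eLpNorm f (ENNReal.ofReal r)⁻¹ (zeroMeasure n) ≤
        C * (eLpNorm f (ENNReal.ofReal s)⁻¹ (zeroMeasure n) +
          ∑ c, eLpNorm (zeroField n c f) (ENNReal.ofReal s)⁻¹ (zeroMeasure n)) := by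
  obtain ⟨C, hC⟩ := eLpNorm_zeroPotential_le n (p := 1 / s) (r := r) ((one_le_div hs0).2 hs1) hr
    (by simpa using hrs) (by simpa using hlt)
  refine ⟨C * 2, fun f hf => ?_⟩
  have hexp : ENNReal.ofReal (1 / s) = (ENNReal.ofReal s)⁻¹ := by
    rw [one_div, ENNReal.ofReal_inv_of_pos hs0]
  have h1 := hC _ (measurable_firstOrderSize hf).enorm
  rw [eLpNorm_enorm, hexp] at h1
  have hp : 1 ≤ (ENNReal.ofReal s)⁻¹ := by
    rw [ENNReal.one_le_inv]
    simpa using hs1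
  calc eLpNorm f (ENNReal.ofReal r)⁻¹ (zeroMeasure n)
      ≤ eLpNorm (zeroPotential n fun w => ‖firstOrderSize n f w‖ₑ) (ENNReal.ofReal r)⁻¹
          (zeroMeasure n) := by
        refine eLpNorm_mono_enorm_ae ?_
        filter_upwards [ae_zeroMeasure_mem n] with z hz using enorm_le_zeroPotential hf hz
    _ ≤ C * eLpNorm (firstOrderSize n f) (ENNReal.ofReal s)⁻¹ (zeroMeasure n) := h1
    _ ≤ C * (2 * _) := by gcongr; exact eLpNorm_firstOrderSize_le hf hp
    _ = _ := by push_cast; ring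

section FieldCalculus

variable {n : ℕ} {f g : ℝ × (Fin n → ℝ) → ℝ}

theorem zeroField_congr (h : EqOn f g (zeroDomain n)) (c : Option (Fin n)) :
    EqOn (zeroField n c f) (zeroField n c g) (zeroDomain n) := fun z hz => by
  have : f =ᶠ[nhds z] g := h.eventuallyEq_of_mem ((isOpen_zeroDomain n).mem_nhds hz)
  simp only [zeroField, this.fderiv_eq]

theorem zeroField_add (hf : ZeroSmooth n f) (hg : ZeroSmooth n g) (c : Option (Fin n)) :
    EqOn (zeroField n c (f + g)) (zeroField n c f + zeroField n c g) (zeroDomain n) :=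
  fun z hz => by
    simp only [zeroField, Pi.add_apply]
    rw [fderiv_add (hf.differentiableAt hz) (hg.differentiableAt hz)]
    simp [mul_add]

theorem zeroField_const_smul (hf : ZeroSmooth n f) (a : ℝ) (c : Option (Fin n)) :
    EqOn (zeroField n c (a • f)) (a • zeroField n c f) (zeroDomain n) := fun z hz => by
  simp only [zeroField, Pi.smul_apply]
  rw [fderiv_const_smul (hf.differentiableAt hz)]
  simp only [smul_apply, smul_eq_mul]
  ring

theorem zeroField_mul (hf : ZeroSmooth n f) (hg : ZeroSmooth n g) (c : Option (Fin n)) :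
    EqOn (zeroField n c (f * g)) (zeroField n c f * g + f * zeroField n c g) (zeroDomain n) :=
  fun z hz => by
    simp only [zeroField, Pi.add_apply, Pi.mul_apply]
    rw [fderiv_mul (hf.differentiableAt hz) (hg.differentiableAt hz)]
    simp only [add_apply, smul_apply, smul_eq_mul]
    ring

end FieldCalculus

/-- The sum of the `L^p` norms of all iterated 0-derivatives of order at most `m`. -/
noncomputable def frameNorm (n : ℕ) (p : ℝ≥0∞) : ℕ → (ℝ × (Fin n → ℝ) → ℝ) → ℝ≥0∞
  | 0, f => eLpNorm f p (zeroMeasure n)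
  | m + 1, f => frameNorm n p m f + ∑ c, frameNorm n p m (zeroField n c f)

section FrameNorm

variable {n : ℕ} {p : ℝ≥0∞} {f g : ℝ × (Fin n → ℝ) → ℝ}

theorem frameNorm_congr (m : ℕ) (h : EqOn f g (zeroDomain n)) :
    frameNorm n p m f = frameNorm n p m g := by
  induction m generalizing f g with
  | zero =>
    refine eLpNorm_congr_ae ?_
    filter_upwards [ae_zeroMeasure_mem n] with z hz using h hz
  | succ m ih =>
    rw [frameNorm, frameNorm, ih h]
    congr 1
    exact Finset.sum_congr rfl fun c _ => ih (zeroField_congr h c)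

theorem frameNorm_zeroField_le (m : ℕ) (f : ℝ × (Fin n → ℝ) → ℝ) (c : Option (Fin n)) :
    frameNorm n p m (zeroField n c f) ≤ frameNorm n p (m + 1) f := by
  rw [frameNorm]
  exact (Finset.single_le_sum (f := fun c => frameNorm n p m (zeroField n c f))
    (fun _ _ => zero_le) (Finset.mem_univ c)).trans le_add_self

theorem frameNorm_mono (f : ℝ × (Fin n → ℝ) → ℝ) : Monotone fun m => frameNorm n p m f :=
  monotone_nat_of_le_succ fun m => by
    simp only [frameNorm]
    exact le_self_add

theorem frameNorm_add_le (hp : 1 ≤ p) (m : ℕ) (hf : ZeroSmooth n f) (hg : ZeroSmooth n g) :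
    frameNorm n p m (f + g) ≤ frameNorm n p m f + frameNorm n p m g := by
  induction m generalizing f g with
  | zero => exact eLpNorm_add_le hf.aestronglyMeasurable hg.aestronglyMeasurable hp
  | succ m ih =>
    simp only [frameNorm]
    calc _ ≤ (frameNorm n p m f + frameNorm n p m g) + ∑ c,
          (frameNorm n p m (zeroField n c f) + frameNorm n p m (zeroField n c g)) := by
          refine add_le_add (ih hf hg) (Finset.sum_le_sum fun c _ => ?_)
          rw [frameNorm_congr m (zeroField_add hf hg c)]
          exact ih (hf.zeroField c) (hg.zeroField c)
      _ = _ := by rw [Finset.sum_add_distrib]; ring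

theorem frameNorm_const_smul (m : ℕ) (a : ℝ) (hf : ZeroSmooth n f) :
    frameNorm n p m (a • f) = ‖a‖ₑ * frameNorm n p m f := by
  induction m generalizing f with
  | zero => exact eLpNorm_const_smul a f p _
  | succ m ih =>
    simp only [frameNorm]
    rw [ih hf, mul_add, Finset.mul_sum]
    congr 1
    refine Finset.sum_congr rfl fun c _ => ?_
    rw [frameNorm_congr m (zeroField_const_smul hf a c), ih (hf.zeroField c)]

end FrameNorm

theorem frameNorm_le_frameNorm_succ (n : ℕ) {r s : ℝ} (hr : 0 ≤ r) (hrs : r ≤ s) (hs0 : 0 < s)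
    (hs1 : s ≤ 1) (hlt : (n + 1) * (s - r) < 1) :
    ∃ C : ℝ≥0, ∀ m f, ZeroSmooth n f →
      frameNorm n (ENNReal.ofReal r)⁻¹ m f ≤
        C * frameNorm n (ENNReal.ofReal s)⁻¹ (m + 1) f := by
  obtain ⟨C, hC⟩ := eLpNorm_le_eLpNorm_zeroField n hr hrs hs0 hs1 hlt
  refine ⟨C, fun m => ?_⟩
  induction m with
  | zero => exact hC
  | succ m ih =>
    intro f hf
    rw [frameNorm, frameNorm, mul_add, Finset.mul_sum]
    exact add_le_add (ih f hf) (Finset.sum_le_sum fun c _ => ih _ (hf.zeroField c))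

/-- Sobolev embedding of `H₀ᵃ` into `L^{1/r}` for `r > 1/2 - a/(n+1)`. -/
theorem eLpNorm_le_frameNorm (n a : ℕ) {r : ℝ} (hr : 0 ≤ r) (hr2 : r ≤ 1 / 2)
    (h : r = 1 / 2 ∨ (n + 1) * (1 / 2 - r) < a) :
    ∃ C : ℝ≥0, ∀ f, ZeroSmooth n f →
      eLpNorm f (ENNReal.ofReal r)⁻¹ (zeroMeasure n) ≤ C * frameNorm n 2 a f := by
  have htwo : (ENNReal.ofReal (1 / 2))⁻¹ = 2 := by
    rw [one_div, ENNReal.ofReal_inv_of_pos two_pos]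
    simp
  have hd : (0 : ℝ) < n + 1 := by positivity
  suffices H : ∀ (a : ℕ) (r : ℝ), 0 ≤ r → r ≤ 1 / 2 → (r = 1 / 2 ∨ (n + 1) * (1 / 2 - r) < a) →
      ∃ C : ℝ≥0, ∀ m f, ZeroSmooth n f →
        frameNorm n (ENNReal.ofReal r)⁻¹ m f ≤ C * frameNorm n 2 (m + a) f by
    obtain ⟨C, hC⟩ := H a r hr hr2 h
    exact ⟨C, fun f hf => by simpa [frameNorm] using hC 0 f hf⟩
  clear h hr hr2 r a
  intro a
  induction a with
  | zero =>
    intro r hr hr2 h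
    have hr3 : r = 1 / 2 := h.elim id fun h => by
      have := mul_nonneg hd.le (sub_nonneg.2 hr2)
      simp only [Nat.cast_zero] at h
      linarith
    subst hr3
    exact ⟨1, fun m f _ => by simp only [htwo, add_zero, ENNReal.coe_one, one_mul, le_refl]⟩
  | succ a ih =>
    intro r hr hr2 h
    rcases h with rfl | h
    · exact ⟨1, fun m f _ => by
        rw [htwo, ENNReal.coe_one, one_mul]
        exact frameNorm_mono f (by omega)⟩
    obtain ⟨s, hrs, hs0, hs2, hsr, hs⟩ : ∃ s, r ≤ s ∧ 0 < s ∧ s ≤ 1 / 2 ∧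
        (n + 1) * (s - r) < 1 ∧ (s = 1 / 2 ∨ (n + 1) * (1 / 2 - s) < a) := by
      push_cast at h
      set e : ℝ := min (1 / 2) ((a + 1 - (n + 1) * (1 / 2 - r)) / 2) with he
      have he0 : 0 < e := lt_min (by norm_num) (by linarith)
      have he1 : e ≤ 1 / 2 := min_le_left _ _
      have he2 : e ≤ (a + 1 - (n + 1) * (1 / 2 - r)) / 2 := min_le_right _ _
      have hstep : 0 < (1 - e) / (n + 1) := div_pos (by linarith) hd
      have hmul : (n + 1) * ((1 - e) / (n + 1)) = 1 - e := mul_div_cancel₀ _ hd.ne'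
      refine ⟨min (1 / 2) (r + (1 - e) / (n + 1)), le_min hr2 (by linarith),
        lt_min (by norm_num) (by linarith), min_le_left _ _, ?_, ?_⟩
      · have := mul_le_mul_of_nonneg_left
          (sub_le_sub_right (min_le_right (1 / 2) (r + (1 - e) / (n + 1))) r) hd.le
        rw [add_sub_cancel_left, hmul] at this
        linarith
      · rcases min_choice (1 / 2) (r + (1 - e) / (n + 1)) with h' | h' <;> rw [h']
        · exact Or.inl rfl
        · right
          have : (n + 1) * (1 / 2 - (r + (1 - e) / (n + 1))) =
            (n + 1) * (1 / 2 - r) - (1 - e) := by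
            linear_combination -hmul
          rw [this]
          linarith
    obtain ⟨C₁, hC₁⟩ := frameNorm_le_frameNorm_succ n hr hrs hs0 (by linarith) hsr
    obtain ⟨C₂, hC₂⟩ := ih s hs0.le hs2 hs
    refine ⟨C₁ * C₂, fun m f hf => (hC₁ m f hf).trans ?_⟩
    rw [ENNReal.coe_mul, mul_assoc]
    gcongr
    simpa [add_assoc, add_comm 1 a] using hC₂ (m + 1) f hf

theorem exists_holder_exponent (n a b : ℕ) (h : ((n : ℝ) + 1) / 2 < a + b) :
    ∃ r : ℝ, 0 ≤ r ∧ r ≤ 1 / 2 ∧ (r = 1 / 2 ∨ (n + 1) * (1 / 2 - r) < a) ∧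
      (1 / 2 - r = 1 / 2 ∨ (n + 1) * (1 / 2 - (1 / 2 - r)) < b) := by
  have hd : (0 : ℝ) < n + 1 := by positivity
  rcases Nat.eq_zero_or_pos a with rfl | ha
  · refine ⟨1 / 2, by norm_num, le_rfl, Or.inl rfl, Or.inr ?_⟩
    push_cast at h
    linarith
  rcases Nat.eq_zero_or_pos b with rfl | hb
  · refine ⟨0, le_rfl, by norm_num, Or.inr ?_, Or.inl (by norm_num)⟩
    push_cast at h
    linarith
  have ha' : (0 : ℝ) < a / (n + 1) := by positivity
  have hb' : (0 : ℝ) < b / (n + 1) := by positivity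
  have hlt : max 0 (1 / 2 - (a : ℝ) / (n + 1)) < min (1 / 2) ((b : ℝ) / (n + 1)) := by
    refine max_lt (lt_min (by norm_num) hb') (lt_min (by linarith) ?_)
    rw [sub_lt_iff_lt_add, ← add_div, lt_div_iff₀ hd]
    linarith
  obtain ⟨r, h1, h2⟩ := exists_between hlt
  obtain ⟨h1, h1'⟩ := max_lt_iff.1 h1
  obtain ⟨h2, h2'⟩ := lt_min_iff.1 h2
  refine ⟨r, h1.le, h2.le, Or.inr ?_, Or.inr ?_⟩
  · rw [mul_comm, ← lt_div_iff₀ hd]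
    linarith
  · rw [mul_comm, ← lt_div_iff₀ hd]
    linarith

theorem eLpNorm_mul_le_frameNorm (n a b : ℕ) (h : ((n : ℝ) + 1) / 2 < a + b) :
    ∃ C : ℝ≥0, ∀ f g, ZeroSmooth n f → ZeroSmooth n g →
      eLpNorm (f * g) 2 (zeroMeasure n) ≤ C * frameNorm n 2 a f * frameNorm n 2 b g := by
  obtain ⟨r, hr0, hr1, hra, hrb⟩ := exists_holder_exponent n a b h
  obtain ⟨C₁, hC₁⟩ := eLpNorm_le_frameNorm n a hr0 hr1 hra
  obtain ⟨C₂, hC₂⟩ := eLpNorm_le_frameNorm n b (r := 1 / 2 - r) (by linarith) (by linarith) hrb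
  have : ENNReal.HolderTriple (ENNReal.ofReal r)⁻¹ (ENNReal.ofReal (1 / 2 - r))⁻¹ 2 := by
    refine ⟨?_⟩
    rw [inv_inv, inv_inv, ← ENNReal.ofReal_add hr0 (by linarith), add_sub_cancel, one_div,
      ENNReal.ofReal_inv_of_pos two_pos]
    simp
  refine ⟨C₁ * C₂, fun f g hf hg => ?_⟩
  calc eLpNorm (f * g) 2 (zeroMeasure n)
      ≤ eLpNorm f (ENNReal.ofReal r)⁻¹ (zeroMeasure n) *
          eLpNorm g (ENNReal.ofReal (1 / 2 - r))⁻¹ (zeroMeasure n) :=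
        eLpNorm_smul_le_mul_eLpNorm (𝕜 := ℝ) (E := ℝ) hg.aestronglyMeasurable hf.aestronglyMeasurable
    _ ≤ (C₁ * frameNorm n 2 a f) * (C₂ * frameNorm n 2 b g) :=
        mul_le_mul' (hC₁ f hf) (hC₂ g hg)
    _ = _ := by push_cast; ring

theorem frameNorm_mul_le (n m a b : ℕ) (ha : m ≤ a) (hb : m ≤ b)
    (h : ((n : ℝ) + 1) / 2 + m < a + b) :
    ∃ C : ℝ≥0, ∀ f g, ZeroSmooth n f → ZeroSmooth n g →
      frameNorm n 2 m (f * g) ≤ C * frameNorm n 2 a f * frameNorm n 2 b g := by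
  induction m generalizing a b with
  | zero => exact eLpNorm_mul_le_frameNorm n a b (by simpa using h)
  | succ m ih =>
    obtain ⟨a, rfl⟩ := Nat.exists_eq_add_of_le' (Nat.le_of_add_left_le ha)
    obtain ⟨b, rfl⟩ := Nat.exists_eq_add_of_le' (Nat.le_of_add_left_le hb)
    push_cast at h
    obtain ⟨C₀, hC₀⟩ := ih (a + 1) (b + 1) (by omega) (by omega) (by push_cast; linarith)
    obtain ⟨C₁, hC₁⟩ := ih a (b + 1) (by omega) (by omega) (by push_cast; linarith)
    obtain ⟨C₂, hC₂⟩ := ih (a + 1) b (by omega) (by omega) (by push_cast; linarith)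
    refine ⟨C₀ + Fintype.card (Option (Fin n)) * (C₁ + C₂), fun f g hf hg => ?_⟩
    set N := frameNorm n 2 (a + 1) f with hN
    set M := frameNorm n 2 (b + 1) g with hM
    have hc : ∀ c, frameNorm n 2 m (zeroField n c (f * g)) ≤ (C₁ + C₂) * N * M := by
      intro c
      rw [frameNorm_congr m (zeroField_mul hf hg c)]
      refine (frameNorm_add_le one_le_two m ((hf.zeroField c).mul hg)
        (hf.mul (hg.zeroField c))).trans ?_
      calc _ ≤ C₁ * frameNorm n 2 a (zeroField n c f) * M +
            C₂ * N * frameNorm n 2 b (zeroField n c g) :=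
            add_le_add (hC₁ _ _ (hf.zeroField c) hg) (hC₂ _ _ hf (hg.zeroField c))
        _ ≤ C₁ * N * M + C₂ * N * M := by
            gcongr
            · exact frameNorm_zeroField_le a f c
            · exact frameNorm_zeroField_le b g c
        _ = _ := by ring
    rw [frameNorm]
    calc _ ≤ C₀ * N * M + ∑ _c : Option (Fin n), (C₁ + C₂) * N * M :=
          add_le_add (hC₀ f g hf hg) (Finset.sum_le_sum fun c _ => hc c)
      _ = _ := by
          rw [Finset.sum_const, nsmul_eq_mul, Finset.card_univ]
          push_cast
          ring

theorem fderiv_fderiv_apply_comm {n : ℕ} {f : ℝ × (Fin n → ℝ) → ℝ} (hf : ZeroSmooth n f)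
    (e e' : ℝ × (Fin n → ℝ)) {z : ℝ × (Fin n → ℝ)} (hz : z ∈ zeroDomain n) :
    fderiv ℝ (fun p => fderiv ℝ f p e) z e' = fderiv ℝ (fun p => fderiv ℝ f p e') z e := by
  have hd : DifferentiableAt ℝ (fderiv ℝ f) z :=
    ((hf.contDiffAt hz).fderiv_right (m := 1) (WithTop.coe_le_coe.2 le_top)).differentiableAt
      (by simp)
  have h : ∀ v w, fderiv ℝ (fun p => fderiv ℝ f p v) z w = fderiv ℝ (fderiv ℝ f) z w v := by
    intro v w
    rw [fderiv_clm_apply hd (differentiableAt_const v)]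
    simp
  rw [h, h]
  exact ((hf.contDiffAt hz).isSymmSndFDerivAt (by
    rw [minSmoothness_of_isRCLikeNormedField]
    exact WithTop.coe_le_coe.2 le_top)) e' e

theorem ZeroSmooth.const_smul {n : ℕ} {f : ℝ × (Fin n → ℝ) → ℝ} (hf : ZeroSmooth n f) (a : ℝ) :
    ZeroSmooth n (a • f) :=
  ContDiffOn.const_smul a hf

section CoordinateDerivatives

variable {n : ℕ} {f g : ℝ × (Fin n → ℝ) → ℝ}

theorem ZeroSmooth.dxj (hf : ZeroSmooth n f) (j : Fin n) : ZeroSmooth n (Dxj n j f) :=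
  hf.fderiv_apply _

theorem ZeroSmooth.dxj_iterate (hf : ZeroSmooth n f) (j : Fin n) (k : ℕ) :
    ZeroSmooth n ((Dxj n j)^[k] f) :=
  Function.Iterate.rec (ZeroSmooth n) hf (fun _ h => ZeroSmooth.dxj h j) k

theorem dxj_congr (h : EqOn f g (zeroDomain n)) (j : Fin n) :
    EqOn (Dxj n j f) (Dxj n j g) (zeroDomain n) := fun z hz => by
  have : f =ᶠ[nhds z] g := h.eventuallyEq_of_mem ((isOpen_zeroDomain n).mem_nhds hz)
  simp only [Dxj, this.fderiv_eq]

theorem dxj_iterate_congr (h : EqOn f g (zeroDomain n)) (j : Fin n) (k : ℕ) :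
    EqOn ((Dxj n j)^[k] f) ((Dxj n j)^[k] g) (zeroDomain n) := by
  induction k generalizing f g with
  | zero => exact h
  | succ k ih => exact ih (dxj_congr h j)

theorem dxj_dxj_iterate (hf : ZeroSmooth n f) (i j : Fin n) (k : ℕ) :
    EqOn (Dxj n j ((Dxj n i)^[k] f)) ((Dxj n i)^[k] (Dxj n j f)) (zeroDomain n) := by
  induction k generalizing f with
  | zero => exact fun _ _ => rfl
  | succ k ih =>
    exact (ih (hf.dxj i)).trans
      (dxj_iterate_congr (fun z hz => fderiv_fderiv_apply_comm hf _ _ hz) i k)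

/-- The iterated derivative `∂_x^α` restricted to the coordinates in `l`. -/
noncomputable def dxList (n : ℕ) (l : List (Fin n)) (α : Fin n → ℕ) :
    (ℝ × (Fin n → ℝ) → ℝ) → (ℝ × (Fin n → ℝ) → ℝ) :=
  l.foldr (fun j F => (Dxj n j)^[α j] ∘ F) id

theorem dxList_cons (i : Fin n) (l : List (Fin n)) (α : Fin n → ℕ) :
    dxList n (i :: l) α f = (Dxj n i)^[α i] (dxList n l α f) := rfl

theorem ZeroSmooth.dxList (hf : ZeroSmooth n f) (l : List (Fin n)) (α : Fin n → ℕ) :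
    ZeroSmooth n (dxList n l α f) := by
  induction l with
  | nil => exact hf
  | cons i l ih => exact ih.dxj_iterate i (α i)

theorem dxList_add_single_of_notMem {l : List (Fin n)} {j : Fin n} (hj : j ∉ l)
    (α : Fin n → ℕ) : dxList n l (α + Pi.single j 1) f = dxList n l α f := by
  induction l with
  | nil => rfl
  | cons i l ih =>
    rw [List.mem_cons, not_or] at hj
    rw [dxList_cons, dxList_cons, ih hj.2]
    simp [Ne.symm hj.1]

theorem dxj_dxList (hf : ZeroSmooth n f) {l : List (Fin n)} (hl : l.Nodup) {j : Fin n}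
    (hj : j ∈ l) (α : Fin n → ℕ) :
    EqOn (Dxj n j (dxList n l α f)) (dxList n l (α + Pi.single j 1) f) (zeroDomain n) := by
  induction l with
  | nil => simp at hj
  | cons i l ih =>
    obtain ⟨hil, hl⟩ := List.nodup_cons.1 hl
    simp only [dxList_cons]
    by_cases hij : j = i
    · subst hij
      rw [dxList_add_single_of_notMem hil, ← Function.iterate_succ_apply' (Dxj n j)]
      simp [EqOn]
    · have hjl : j ∈ l := (List.mem_cons.1 hj).resolve_left hij
      have hαi : (α + Pi.single j 1 : Fin n → ℕ) i = α i := by simp [Ne.symm hij]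
      rw [hαi]
      exact (dxj_dxj_iterate (hf.dxList l α) i j (α i)).trans
        (dxj_iterate_congr (ih hl hjl) i (α i))

end CoordinateDerivatives

section ZeroDerivatives

variable {n : ℕ} {f g : ℝ × (Fin n → ℝ) → ℝ}

/-- The derivative `(τ∂_x)^α = τ^{|α|} ∂_x^α`. -/
noncomputable def zeroDx (n : ℕ) (α : Fin n → ℕ) (f : ℝ × (Fin n → ℝ) → ℝ) :
    ℝ × (Fin n → ℝ) → ℝ :=
  fun p => p.1 ^ (∑ j, α j) * DxAlpha n α f p

theorem zeroDeriv_eq_iterate (i : ℕ) (α : Fin n → ℕ) (f : ℝ × (Fin n → ℝ) → ℝ) :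
    zeroDeriv n i α f = (zeroField n none)^[i] (zeroDx n α f) := rfl

theorem ZeroSmooth.zeroDx (hf : ZeroSmooth n f) (α : Fin n → ℕ) : ZeroSmooth n (zeroDx n α f) :=
  (contDiffOn_fst.pow _).mul (hf.dxList (List.finRange n) α)

theorem ZeroSmooth.zeroField_iterate (hf : ZeroSmooth n f) (c : Option (Fin n)) (i : ℕ) :
    ZeroSmooth n ((_root_.zeroField n c)^[i] f) :=
  Function.Iterate.rec (ZeroSmooth n) hf (fun _ h => ZeroSmooth.zeroField h c) i

theorem ZeroSmooth.zeroDeriv (hf : ZeroSmooth n f) (i : ℕ) (α : Fin n → ℕ) :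
    ZeroSmooth n (zeroDeriv n i α f) :=
  (hf.zeroDx α).zeroField_iterate none i

theorem zeroDx_zero (f : ℝ × (Fin n → ℝ) → ℝ) : zeroDx n 0 f = f := by
  have h : ∀ l : List (Fin n), dxList n l 0 f = f := by
    intro l
    induction l with
    | nil => rfl
    | cons i l ih => rw [dxList_cons, ih]; rfl
  funext p
  simp [zeroDx, show DxAlpha n 0 f = f from h _]

theorem zeroField_zeroDx (hf : ZeroSmooth n f) (j : Fin n) (α : Fin n → ℕ) :
    EqOn (zeroField n (some j) (zeroDx n α f)) (zeroDx n (α + Pi.single j 1) f)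
      (zeroDomain n) := fun z hz => by
  have h1 : Dxj n j (DxAlpha n α f) z = DxAlpha n (α + Pi.single j 1) f z :=
    dxj_dxList hf (List.nodup_finRange n) (List.mem_finRange j) α hz
  have h2 : ∑ i, (α + Pi.single j 1 : Fin n → ℕ) i = ∑ i, α i + 1 := by
    simp [Finset.sum_add_distrib]
  have h3 : HasFDerivAt (fun p : ℝ × (Fin n → ℝ) => p.1 ^ (∑ i, α i)) _ z :=
    (hasFDerivAt_fst (𝕜 := ℝ)).pow (∑ i, α i)
  have h4 : DifferentiableAt ℝ (DxAlpha n α f) z :=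
    (hf.dxList (List.finRange n) α).differentiableAt hz
  have hd : fderiv ℝ (zeroDx n α f) z = _ := fderiv_fun_mul h3.differentiableAt h4
  simp only [zeroField]
  rw [hd, zeroDx, h3.fderiv, ← h1, h2, pow_succ]
  simp only [coordFrame, Dxj, add_apply, smul_apply, smul_eq_mul,
    ContinuousLinearMap.coe_fst', mul_zero, add_zero, nsmul_eq_mul]
  ring

theorem zeroField_some_none (hf : ZeroSmooth n f) (j : Fin n) :
    EqOn (zeroField n (some j) (zeroField n none f))
      (zeroField n none (zeroField n (some j) f) + (-1 : ℝ) • zeroField n (some j) f)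
      (zeroDomain n) := fun z hz => by
  have h : ∀ c c', zeroField n c' (zeroField n c f) z =
      z.1 * (z.1 * fderiv ℝ (fun p => fderiv ℝ f p (coordFrame n c)) z (coordFrame n c') +
        fderiv ℝ f z (coordFrame n c) * (coordFrame n c').1) := by
    intro c c'
    have h1 : HasFDerivAt (fun p : ℝ × (Fin n → ℝ) => p.1)
        (ContinuousLinearMap.fst ℝ ℝ (Fin n → ℝ)) z := hasFDerivAt_fst
    have h2 := (hf.fderiv_apply (coordFrame n c)).differentiableAt hz
    unfold zeroField
    rw [fderiv_fun_mul h1.differentiableAt h2, h1.fderiv]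
    simp
  simp only [Pi.add_apply, Pi.smul_apply, h]
  rw [fderiv_fderiv_apply_comm hf _ _ hz]
  simp only [zeroField, coordFrame, smul_eq_mul]
  ring

theorem zeroField_iterate_congr (h : EqOn f g (zeroDomain n)) (c : Option (Fin n)) (i : ℕ) :
    EqOn ((zeroField n c)^[i] f) ((zeroField n c)^[i] g) (zeroDomain n) := by
  induction i generalizing f g with
  | zero => exact h
  | succ i ih => exact ih (zeroField_congr h c)

theorem zeroField_iterate_add_smul (hf : ZeroSmooth n f) (hg : ZeroSmooth n g) (a : ℝ)
    (c : Option (Fin n)) (i : ℕ) :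
    EqOn ((zeroField n c)^[i] (f + a • g))
      ((zeroField n c)^[i] f + a • (zeroField n c)^[i] g) (zeroDomain n) := by
  induction i generalizing f g with
  | zero => exact fun _ _ => rfl
  | succ i ih =>
    refine (zeroField_iterate_congr (fun z hz => ?_) c i).trans
      (ih (hf.zeroField c) (hg.zeroField c))
    rw [zeroField_add hf (hg.const_smul a) c hz, Pi.add_apply, Pi.add_apply,
      zeroField_const_smul hg a c hz]

/-- Moving `τ∂_{x_j}` past powers of `τ∂_τ` costs only lower powers of `τ∂_τ`. -/
theorem frameNorm_zeroField_iterate_le {p : ℝ≥0∞} (hp : 1 ≤ p) (m i : ℕ) (j : Fin n)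
    (hf : ZeroSmooth n f) {B : ℝ≥0∞}
    (hB : ∀ l ≤ i, frameNorm n p m ((zeroField n none)^[l] (zeroField n (some j) f)) ≤ B) :
    frameNorm n p m (zeroField n (some j) ((zeroField n none)^[i] f)) ≤ 2 ^ i * B := by
  induction i generalizing f B with
  | zero => simpa using hB 0 le_rfl
  | succ i ih =>
    rw [Function.iterate_succ_apply, pow_succ, mul_assoc]
    refine ih (hf.zeroField none) fun l hl => ?_
    have hX := hf.zeroField (some j)
    have h := (zeroField_iterate_congr (zeroField_some_none hf j) none l).trans
      (zeroField_iterate_add_smul (hX.zeroField none) hX (-1) none l)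
    rw [frameNorm_congr m h]
    refine (frameNorm_add_le hp m ((hX.zeroField none).zeroField_iterate none l)
      ((hX.zeroField_iterate none l).const_smul (-1))).trans ?_
    rw [frameNorm_const_smul m _ (hX.zeroField_iterate none l), two_mul]
    refine add_le_add (hB (l + 1) (by omega)) ?_
    simpa using hB l (by omega)

theorem frameNorm_zeroDx_le (p : ℝ≥0∞) (m : ℕ) (α : Fin n → ℕ) (hf : ZeroSmooth n f) :
    frameNorm n p m (zeroDx n α f) ≤ frameNorm n p (m + ∑ j, α j) f := by
  induction hs : ∑ j, α j generalizing α m with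
  | zero =>
    have : α = 0 := by
      funext j
      simpa using (Finset.sum_eq_zero_iff.1 hs) j (Finset.mem_univ j)
    simp [this, zeroDx_zero]
  | succ s ih =>
    obtain ⟨j, -, hj⟩ := Finset.exists_ne_zero_of_sum_ne_zero (hs.trans_ne (Nat.succ_ne_zero s))
    obtain ⟨β, rfl⟩ : ∃ β, α = β + Pi.single j 1 := by
      refine ⟨α - Pi.single j 1, (tsub_add_cancel_of_le ?_).symm⟩
      intro i
      by_cases hij : i = j
      · subst hij
        simpa using Nat.one_le_iff_ne_zero.2 hj
      · simp [hij]
    have hβ : ∑ i, β i = s := by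
      simpa [Finset.sum_add_distrib] using hs
    rw [← frameNorm_congr m (zeroField_zeroDx hf j β)]
    refine (frameNorm_zeroField_le m _ _).trans ((ih (m + 1) β hβ).trans_eq ?_)
    rw [add_assoc, add_comm 1 s]

theorem frameNorm_zeroDeriv_le (p : ℝ≥0∞) (m i : ℕ) (α : Fin n → ℕ) (hf : ZeroSmooth n f) :
    frameNorm n p m (zeroDeriv n i α f) ≤ frameNorm n p (m + i + ∑ j, α j) f := by
  rw [zeroDeriv_eq_iterate]
  refine le_trans ?_ (frameNorm_zeroDx_le p (m + i) α hf)
  induction i generalizing m with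
  | zero => exact le_rfl
  | succ i ih =>
    rw [Function.iterate_succ_apply']
    refine (frameNorm_zeroField_le m _ _).trans ((ih (m + 1)).trans_eq ?_)
    rw [add_assoc, add_comm 1 i]

end ZeroDerivatives

theorem mem_zeroIndex {n k : ℕ} {q : ℕ × (Fin n → ℕ)} :
    q ∈ zeroIndex n k ↔ q.1 + ∑ j, q.2 j ≤ k := by
  simp only [zeroIndex, Finset.mem_filter, Finset.mem_product, Finset.mem_range,
    Fintype.mem_piFinset, and_iff_right_iff_imp]
  intro h
  refine ⟨by omega, fun j => ?_⟩
  have := Finset.single_le_sum (f := q.2) (fun _ _ => Nat.zero_le _) (Finset.mem_univ j)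
  omega

theorem zeroSobNormSq_eq (n k : ℕ) {f : ℝ × (Fin n → ℝ) → ℝ} (hf : ZeroSmooth n f) :
    zeroSobNormSq n k f =
      ∑ q ∈ zeroIndex n k, eLpNorm (zeroDeriv n q.1 q.2 f) 2 (zeroMeasure n) ^ (2 : ℝ) := by
  refine Finset.sum_congr rfl fun q _ => ?_
  have hm := ((ContDiffOn.continuousOn (hf.zeroDeriv q.1 q.2)).aemeasurable
    (μ := volume) (measurableSet_zeroDomain n)).enorm.pow_const (2 : ℝ)
  rw [eLpNorm_eq_lintegral_rpow_enorm_toReal two_ne_zero ENNReal.ofNat_ne_top,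
    ENNReal.toReal_ofNat, one_div, ENNReal.rpow_inv_rpow two_ne_zero, zeroMeasure,
    lintegral_withDensity_eq_lintegral_mul₀ (measurable_zeroDensity n).aemeasurable hm]
  refine setLIntegral_congr_fun (measurableSet_zeroDomain n) fun z hz => ?_
  simp only [Pi.mul_apply]
  rw [Real.enorm_eq_ofReal_abs, ENNReal.ofReal_rpow_of_nonneg (abs_nonneg _) two_pos.le,
    ← ENNReal.ofReal_mul (zpow_nonneg (mem_zeroDomain.1 hz).1.le _), mul_comm]
  simp

theorem eLpNorm_zeroDeriv_le_zeroSobNorm {n k : ℕ} {f : ℝ × (Fin n → ℝ) → ℝ}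
    (hf : ZeroSmooth n f) {i : ℕ} {α : Fin n → ℕ} (h : i + ∑ j, α j ≤ k) :
    eLpNorm (zeroDeriv n i α f) 2 (zeroMeasure n) ≤ zeroSobNorm n k f := by
  have hq : ((i, α) : ℕ × (Fin n → ℕ)) ∈ zeroIndex n k := mem_zeroIndex.2 h
  rw [zeroSobNorm, one_div, ENNReal.le_rpow_inv_iff two_pos, zeroSobNormSq_eq n k hf]
  generalize zeroIndex n k = s at hq
  rw [← Finset.add_sum_erase s _ hq]
  exact le_self_add

theorem frameNorm_le_zeroSobNorm (n k : ℕ) :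
    ∃ C : ℝ≥0, ∀ f, ZeroSmooth n f → frameNorm n 2 k f ≤ C * zeroSobNorm n k f := by
  suffices H : ∀ m, ∃ C : ℝ≥0, ∀ (i : ℕ) (α : Fin n → ℕ), m + i + ∑ j, α j ≤ k →
      ∀ f, ZeroSmooth n f → frameNorm n 2 m (zeroDeriv n i α f) ≤ C * zeroSobNorm n k f by
    obtain ⟨C, hC⟩ := H k
    refine ⟨C, fun f hf => ?_⟩
    have := hC 0 0 (by simp) f hf
    rwa [zeroDeriv_eq_iterate, zeroDx_zero] at this
  intro m
  induction m with
  | zero =>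
    exact ⟨1, fun i α h f hf => by
      simpa [frameNorm] using eLpNorm_zeroDeriv_le_zeroSobNorm hf (by simpa using h)⟩
  | succ m ih =>
    obtain ⟨C, hC⟩ := ih
    refine ⟨C + Fintype.card (Option (Fin n)) * (2 ^ k * C), fun i α h f hf => ?_⟩
    have hc : ∀ c, frameNorm n 2 m (zeroField n c (zeroDeriv n i α f)) ≤
        2 ^ k * (C * zeroSobNorm n k f) := by
      rintro (_ | j)
      · have h1 := hC (i + 1) α (by omega) f hf
        rw [zeroDeriv_eq_iterate, Function.iterate_succ_apply'] at h1
        exact h1.trans (le_mul_of_one_le_left' (one_le_pow₀ one_le_two))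
      · refine (frameNorm_zeroField_iterate_le one_le_two m i j (hf.zeroDx α)
          (B := C * zeroSobNorm n k f) fun l hl => ?_).trans ?_
        · rw [frameNorm_congr m (zeroField_iterate_congr (zeroField_zeroDx hf j α) none l),
            ← zeroDeriv_eq_iterate]
          refine hC l _ ?_ f hf
          simp only [Pi.add_apply, Finset.sum_add_distrib, Finset.sum_pi_single',
            Finset.mem_univ, if_true]
          omega
        · gcongr
          · exact one_le_two
          · omega
    rw [frameNorm]
    calc _ ≤ C * zeroSobNorm n k f +
          ∑ _c : Option (Fin n), 2 ^ k * (C * zeroSobNorm n k f) :=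
          add_le_add (hC i α (by omega) f hf) (Finset.sum_le_sum fun c _ => hc c)
      _ = _ := by
          rw [Finset.sum_const, nsmul_eq_mul, Finset.card_univ]
          push_cast
          ring

theorem zeroSobNorm_le_frameNorm (n k : ℕ) :
    ∃ C : ℝ≥0, ∀ f, ZeroSmooth n f → zeroSobNorm n k f ≤ C * frameNorm n 2 k f := by
  refine ⟨((zeroIndex n k).card : ℝ≥0) ^ (1 / 2 : ℝ), fun f hf => ?_⟩
  rw [zeroSobNorm, zeroSobNormSq_eq n k hf]
  have hle : ∀ q ∈ zeroIndex n k,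
      eLpNorm (zeroDeriv n q.1 q.2 f) 2 (zeroMeasure n) ≤ frameNorm n 2 k f := fun q hq => by
    refine (frameNorm_zeroDeriv_le 2 0 q.1 q.2 hf).trans (frameNorm_mono f ?_)
    simpa using mem_zeroIndex.1 hq
  calc _ ≤ ((zeroIndex n k).card * frameNorm n 2 k f ^ (2 : ℝ)) ^ (1 / 2 : ℝ) := by
        gcongr
        rw [← nsmul_eq_mul, ← Finset.sum_const]
        exact Finset.sum_le_sum fun q hq => ENNReal.rpow_le_rpow (hle q hq) two_pos.le
    _ = _ := by
        rw [ENNReal.mul_rpow_of_nonneg _ _ (by norm_num), one_div,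
          ENNReal.rpow_rpow_inv two_ne_zero, ENNReal.coe_rpow_of_nonneg _ (by norm_num),
          ENNReal.coe_natCast]

/-- For `k > (n+1)/2`, the 0-Sobolev space `H₀ᵏ` on `(0,1)×ℝⁿ` is an
algebra: there is `C > 0` with `‖uv‖_{H₀ᵏ} ≤ C ‖u‖_{H₀ᵏ} ‖v‖_{H₀ᵏ}` for all smooth
`u, v` with finite norm. -/
theorem stmt_4 (n k : ℕ) (hk : (k : ℝ) > (n + 1) / 2) :
    ∃ C : ℝ, 0 < C ∧
      ∀ u v : ℝ × (Fin n → ℝ) → ℝ,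
        ContDiffOn ℝ (⊤ : ℕ∞) u (Set.Ioo (0 : ℝ) 1 ×ˢ (Set.univ : Set (Fin n → ℝ))) →
        ContDiffOn ℝ (⊤ : ℕ∞) v (Set.Ioo (0 : ℝ) 1 ×ˢ (Set.univ : Set (Fin n → ℝ))) →
        zeroSobNorm n k u < ⊤ → zeroSobNorm n k v < ⊤ →
        zeroSobNorm n k (fun p => u p * v p) ≤
          ENNReal.ofReal C * zeroSobNorm n k u * zeroSobNorm n k v := by
  obtain ⟨C₁, hC₁⟩ := zeroSobNorm_le_frameNorm n k
  obtain ⟨C₂, hC₂⟩ := frameNorm_mul_le n k k k le_rfl le_rfl (by linarith)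
  obtain ⟨C₃, hC₃⟩ := frameNorm_le_zeroSobNorm n k
  refine ⟨C₁ * C₂ * C₃ * C₃ + 1, by positivity, fun u v hu hv _ _ => ?_⟩
  have hu' : ZeroSmooth n u := hu
  have hv' : ZeroSmooth n v := hv
  calc zeroSobNorm n k (u * v) ≤ C₁ * frameNorm n 2 k (u * v) := hC₁ _ (hu'.mul hv')
    _ ≤ C₁ * (C₂ * (C₃ * zeroSobNorm n k u) * (C₃ * zeroSobNorm n k v)) := by
        gcongr
        refine (hC₂ u v hu' hv').trans ?_
        gcongr
        · exact hC₃ u hu'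
        · exact hC₃ v hv'
    _ = ((C₁ * C₂ * C₃ * C₃ : ℝ≥0) : ℝ≥0∞) * zeroSobNorm n k u * zeroSobNorm n k v := by
        push_cast
        ring
    _ ≤ _ := by
        gcongr
        rw [← ENNReal.ofReal_coe_nnreal]
        refine ENNReal.ofReal_le_ofReal ?_
        push_cast
        linarith
end

section
/- Let Ω ⊂ ℝ³ be a bounded nonempty open set with smooth boundary. Let f : ℝ³ → ℝ³ be smooth with compact support contained in Ω, and suppose that ∫_Ω ⟨V(x), f(x)⟩ dx = 0 for every smooth V : Ω → ℝ³ satisfying the conformal Killing equation ∂_i V_j + ∂_j V_i = (2/3)(div V) δ_{ij} on Ω. Then there exists a smooth map k : ℝ³ → ℝ^{3×3} taking values in symmetric matrices, with tr k(x) = 0 for all x, with supp k contained in the closure of Ω, and with −Σ_{i=1}^3 ∂_i k_{ij} = f_j on ℝ³ for j = 1, 2, 3. -/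
open MeasureTheory
open scoped InnerProductSpace

/-- The partial derivative `∂_i w` of a scalar function `w` on `ℝ³` in the `i`-th
coordinate direction. -/
noncomputable def pd (i : Fin 3) (w : EuclideanSpace ℝ (Fin 3) → ℝ)
    (x : EuclideanSpace ℝ (Fin 3)) : ℝ :=
  fderiv ℝ w x (EuclideanSpace.single i 1)

/-- `Ω ⊂ ℝ³` has smooth boundary: near each boundary point, `Ω` is the sublevel set of a
smooth local defining function with nonvanishing differential. -/
def HasSmoothBoundary (Ω : Set (EuclideanSpace ℝ (Fin 3))) : Prop :=
  ∀ x ∈ frontier Ω,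
    ∃ (U : Set (EuclideanSpace ℝ (Fin 3))) (f : EuclideanSpace ℝ (Fin 3) → ℝ),
      IsOpen U ∧ x ∈ U ∧ ContDiff ℝ (⊤ : ℕ∞) f ∧ (∀ y ∈ U, (y ∈ Ω ↔ f y < 0)) ∧
      ∀ y ∈ U ∩ frontier Ω, fderiv ℝ f y ≠ 0

/-- Euclidean three-space. -/
abbrev Space3 := EuclideanSpace ℝ (Fin 3)

/-- The space `C_c^∞(Ω)` of smooth functions with compact support in `Ω`. -/
def testFunctions (Ω : Set Space3) : Submodule ℝ (Space3 → ℝ) where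
  carrier := {g | ContDiff ℝ (⊤ : ℕ∞) g ∧ HasCompactSupport g ∧ tsupport g ⊆ Ω}
  zero_mem' := ⟨contDiff_const, HasCompactSupport.zero, by simp [tsupport]⟩
  add_mem' := fun ha hb => ⟨ha.1.add hb.1, ha.2.1.add hb.2.1,
    (tsupport_add _ _).trans (Set.union_subset ha.2.2 hb.2.2)⟩
  smul_mem' := fun c g hg => ⟨contDiff_const.smul hg.1, hg.2.1.smul_left (f := fun _ => c),
    (tsupport_smul_subset_right (fun _ => c) g).trans hg.2.2⟩

namespace testFunctions

variable {Ω : Set Space3} {g : Space3 → ℝ}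

lemma differentiable (hg : g ∈ testFunctions Ω) : Differentiable ℝ g :=
  hg.1.differentiable (by simp)

lemma integrable (hg : g ∈ testFunctions Ω) : Integrable g :=
  hg.1.continuous.integrable_of_hasCompactSupport hg.2.1

lemma pd_mem (i : Fin 3) (hg : g ∈ testFunctions Ω) : pd i g ∈ testFunctions Ω :=
  ⟨(hg.1.fderiv_right (by simp)).clm_apply contDiff_const, hg.2.1.fderiv_apply ℝ _,
    (tsupport_fderiv_apply_subset ℝ _).trans hg.2.2⟩

lemma mul_mem {w : Space3 → ℝ} (hw : ContDiff ℝ (⊤ : ℕ∞) w) (hg : g ∈ testFunctions Ω) :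
    w * g ∈ testFunctions Ω :=
  ⟨hw.mul hg.1, hg.2.1.mul_left, (tsupport_mul_subset_right).trans hg.2.2⟩

lemma integral_pd (i : Fin 3) (hg : g ∈ testFunctions Ω) : ∫ x, pd i g x = 0 := by
  have h := integral_mul_fderiv_eq_neg_fderiv_mul_of_integrable (μ := (volume : Measure Space3))
    (f := fun _ => (1 : ℝ)) (g := g) (v := EuclideanSpace.single i 1) (by simp)
    (by simpa using! integrable (pd_mem i hg)) (by simpa using integrable hg)
    (fun x _ => differentiableAt_const _) (fun x _ => differentiable hg x)
  simpa [pd] using h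

end testFunctions

lemma pd_add (i : Fin 3) {g h : Space3 → ℝ} (hg : Differentiable ℝ g) (hh : Differentiable ℝ h) :
    pd i (g + h) = pd i g + pd i h := by
  ext x; simp [pd, fderiv_add (hg x) (hh x)]

lemma pd_mul (i : Fin 3) {g h : Space3 → ℝ} (hg : Differentiable ℝ g) (hh : Differentiable ℝ h) :
    pd i (g * h) = g * pd i h + h * pd i g := by
  ext x; simp [pd, fderiv_mul (hg x) (hh x)]

lemma pd_smul (i : Fin 3) (c : ℝ) (g : Space3 → ℝ) : pd i (c • g) = c • pd i g := by
  ext x; simp [pd, fderiv_const_smul_field]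

lemma pd_comm (i j : Fin 3) {g : Space3 → ℝ} (hg : ContDiff ℝ (⊤ : ℕ∞) g) :
    pd i (pd j g) = pd j (pd i g) := by
  have key : ∀ i j x, pd i (pd j g) x =
      fderiv ℝ (fderiv ℝ g) x (EuclideanSpace.single i 1) (EuclideanSpace.single j 1) := by
    intro i j x
    have hd : DifferentiableAt ℝ (fderiv ℝ g) x :=
      ((hg.fderiv_right (m := (⊤ : ℕ∞)) (by simp)).differentiable (by simp)) x
    change fderiv ℝ (fun y => fderiv ℝ g y (EuclideanSpace.single j 1)) x _ = _
    rw [fderiv_clm_apply hd (differentiableAt_const _)]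
    simp
  ext x
  rw [key, key]
  exact (hg.contDiffAt.isSymmSndFDerivAt
    (by simpa using WithTop.coe_le_coe.2 (le_top (a := (2 : ℕ∞))))) _ _

/-- The `m`-th coordinate function. -/
def coord (m : Fin 3) : Space3 → ℝ := fun x => x m

lemma contDiff_coord (m : Fin 3) : ContDiff ℝ (⊤ : ℕ∞) (coord m) := by
  unfold coord; fun_prop

lemma pd_coord (i m : Fin 3) : pd i (coord m) = fun _ => if i = m then 1 else 0 := by
  ext x
  have : coord m = (EuclideanSpace.proj m : Space3 →L[ℝ] ℝ) := rfl
  rw [pd, this, ContinuousLinearMap.fderiv]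
  simp [eq_comm]

/-- A function is locally constant on `Ω` when it is constant near each point of `Ω`. -/
def LocallyConstantOn (φ : Space3 → ℝ) (Ω : Set Space3) : Prop :=
  ∀ x ∈ Ω, ∀ᶠ y in nhds x, φ y = φ x

namespace LocallyConstantOn

variable {Ω : Set Space3} {φ g : Space3 → ℝ}

lemma contDiffAt (hφ : LocallyConstantOn φ Ω) {x : Space3} (hx : x ∈ Ω) :
    ContDiffAt ℝ (⊤ : ℕ∞) φ x :=
  contDiffAt_const.congr_of_eventuallyEq (hφ x hx)

lemma pd_mul (hφ : LocallyConstantOn φ Ω) {x : Space3} (hx : x ∈ Ω) (i : Fin 3)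
    (g : Space3 → ℝ) : pd i (fun y => φ y * g y) x = φ x * pd i g x := by
  have h : (fun y => φ y * g y) =ᶠ[nhds x] φ x • g := by
    filter_upwards [hφ x hx] with y hy
    simp [hy]
  rw [pd, h.fderiv_eq]
  exact congrFun (pd_smul i (φ x) g) x

lemma mul_mem (hφ : LocallyConstantOn φ Ω) (hg : g ∈ testFunctions Ω) :
    (fun y => φ y * g y) ∈ testFunctions Ω := by
  refine ⟨contDiff_iff_contDiffAt.2 fun x => ?_, hg.2.1.mul_left,
    (tsupport_mul_subset_right).trans hg.2.2⟩
  by_cases hx : x ∈ tsupport g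
  · exact (hφ.contDiffAt (hg.2.2 hx)).mul hg.1.contDiffAt
  · refine (contDiffAt_const (c := (0 : ℝ))).congr_of_eventuallyEq ?_
    filter_upwards [notMem_tsupport_iff_eventuallyEq.1 hx] with y hy
    simp [hy]

lemma integral_mul_pd (hφ : LocallyConstantOn φ Ω) (i : Fin 3) (hg : g ∈ testFunctions Ω) :
    ∫ x, φ x * pd i g x = 0 := by
  rw [← testFunctions.integral_pd i (hφ.mul_mem hg)]
  refine integral_congr_ae (Filter.Eventually.of_forall fun x => ?_)
  by_cases hx : x ∈ tsupport g
  · exact (hφ.pd_mul (hg.2.2 hx) i g).symm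
  · have h0 := notMem_tsupport_iff_eventuallyEq.1 hx
    have h1 : (fun y => φ y * g y) =ᶠ[nhds x] fun _ => 0 := by
      filter_upwards [h0] with y hy
      simp [hy]
    simp [pd, h0.fderiv_eq, h1.fderiv_eq, fderiv_zero]

end LocallyConstantOn

namespace testFunctions

variable (Ω : Set Space3)

/-- Partial differentiation on test functions. -/
noncomputable def partialDeriv (i : Fin 3) : testFunctions Ω →ₗ[ℝ] testFunctions Ω where
  toFun g := ⟨pd i g, pd_mem i g.2⟩
  map_add' g h := Subtype.ext (pd_add i (differentiable g.2) (differentiable h.2))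
  map_smul' c g := Subtype.ext (pd_smul i c g)

/-- Multiplication of test functions by a coordinate. -/
noncomputable def mulCoord (m : Fin 3) : testFunctions Ω →ₗ[ℝ] testFunctions Ω where
  toFun g := ⟨coord m * g, mul_mem (contDiff_coord m) g.2⟩
  map_add' _ _ := Subtype.ext (mul_add _ _ _)
  map_smul' _ _ := Subtype.ext (mul_smul_comm _ _ _)

/-- The divergence of a triple of test functions. -/
noncomputable def divergence : (Fin 3 → testFunctions Ω) →ₗ[ℝ] (Space3 → ℝ) :=
  ∑ i, (testFunctions Ω).subtype ∘ₗ partialDeriv Ω i ∘ₗ LinearMap.proj i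

variable {Ω}

lemma divergence_apply (u : Fin 3 → testFunctions Ω) :
    divergence Ω u = ∑ i, pd i (u i) := by
  simp [divergence, partialDeriv]

lemma pd_mem_range_divergence (i : Fin 3) {g : Space3 → ℝ} (hg : g ∈ testFunctions Ω) :
    pd i g ∈ LinearMap.range (divergence Ω) := by
  refine ⟨Pi.single i ⟨g, hg⟩, ?_⟩
  have h : divergence Ω (Pi.single i ⟨g, hg⟩) =
      ∑ j, (testFunctions Ω).subtype (partialDeriv Ω j (Pi.single (M := fun _ => testFunctions Ω)
        i ⟨g, hg⟩ j)) := by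
    simp [divergence]
  rw [h, Finset.sum_eq_single i]
  · simp [partialDeriv]
  · intro j _ hj
    simp [Pi.single_eq_of_ne hj]
  · simp

lemma integral_eq_zero_of_mem_range_divergence {g : Space3 → ℝ}
    (hg : g ∈ LinearMap.range (divergence Ω)) : ∫ x, g x = 0 := by
  obtain ⟨u, rfl⟩ := hg
  simp only [divergence_apply, Finset.sum_apply]
  rw [integral_finsetSum _ fun i _ => integrable (pd_mem i (u i).2)]
  exact Finset.sum_eq_zero fun i _ => integral_pd i (u i).2

lemma partialDeriv_comm (i j : Fin 3) (g : testFunctions Ω) :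
    partialDeriv Ω i (partialDeriv Ω j g) = partialDeriv Ω j (partialDeriv Ω i g) :=
  Subtype.ext (pd_comm i j g.2.1)

lemma partialDeriv_mulCoord (i m : Fin 3) (g : testFunctions Ω) :
    partialDeriv Ω i (mulCoord Ω m g) =
      mulCoord Ω m (partialDeriv Ω i g) + (if i = m then (1 : ℝ) else 0) • g := by
  refine Subtype.ext ?_
  change pd i (coord m * g) = coord m * pd i g + (if i = m then (1 : ℝ) else 0) • (g : Space3 → ℝ)
  rw [pd_mul i ((contDiff_coord m).differentiable (by simp)) (differentiable g.2), pd_coord]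
  ext x
  by_cases h : i = m <;> simp [h]

end testFunctions

/-- Integration of test functions against a locally constant weight. -/
noncomputable def LocallyConstantOn.weightedIntegral {Ω : Set Space3} {φ : Space3 → ℝ}
    (hφ : LocallyConstantOn φ Ω) : testFunctions Ω →ₗ[ℝ] ℝ where
  toFun g := ∫ x, φ x * (g : Space3 → ℝ) x
  map_add' g h := by
    rw [← integral_add (testFunctions.integrable (hφ.mul_mem g.2))
      (testFunctions.integrable (hφ.mul_mem h.2))]
    simp [mul_add]
  map_smul' c g := by
    rw [RingHom.id_apply, smul_eq_mul, ← integral_const_mul]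
    simp [mul_left_comm]

lemma LocallyConstantOn.weightedIntegral_partialDeriv {Ω : Set Space3} {φ : Space3 → ℝ}
    (hφ : LocallyConstantOn φ Ω) (i : Fin 3) (g : testFunctions Ω) :
    hφ.weightedIntegral (testFunctions.partialDeriv Ω i g) = 0 :=
  hφ.integral_mul_pd i g.2

lemma LocallyConstantOn.weightedIntegral_mulCoord_partialDeriv {Ω : Set Space3} {φ : Space3 → ℝ}
    (hφ : LocallyConstantOn φ Ω) (m i : Fin 3) (g : testFunctions Ω) :
    hφ.weightedIntegral (testFunctions.mulCoord Ω m (testFunctions.partialDeriv Ω i g)) =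
      -((if i = m then 1 else 0) * hφ.weightedIntegral g) := by
  have h := hφ.weightedIntegral_partialDeriv i (testFunctions.mulCoord Ω m g)
  rw [testFunctions.partialDeriv_mulCoord, map_add, map_smul, smul_eq_mul] at h
  linarith

section TensorAlgebra

variable {M : Type*} [AddCommGroup M] [Module ℝ M] {d : Fin 3 → M →ₗ[ℝ] M}

lemma sum_sum_antisymm_eq_zero (hd : ∀ i j g, d i (d j g) = d j (d i g))
    {A : Fin 3 → Fin 3 → M} (hA : ∀ l i, A l i = -A i l) :
    ∑ i, d i (∑ l, d l (A l i)) = 0 := by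
  have h : ∑ i, d i (∑ l, d l (A l i)) = -∑ i, d i (∑ l, d l (A l i)) := by
    simp only [map_sum]
    conv_lhs => rw [Finset.sum_comm]
    simp only [← Finset.sum_neg_distrib]
    refine Finset.sum_congr rfl fun i _ => Finset.sum_congr rfl fun l _ => ?_
    rw [hd, hA, map_neg, map_neg]
  have := IsAddTorsionFree.of_isTorsionFree ℝ M
  exact self_eq_neg.1 h

/-- Symmetrization and trace removal: if the antisymmetric part and the trace of `T` are
divergences whose potentials are compatible up to another divergence, then `T` differs from a
symmetric trace-free tensor by a divergence-free one. -/
lemma exists_symm_traceFree_div_eq (hd : ∀ i j g, d i (d j g) = d j (d i g))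
    {T P : Fin 3 → Fin 3 → M} {B : Fin 3 → Fin 3 → Fin 3 → M} {C : Fin 3 → M}
    (hBanti : ∀ l a b, B l a b = -B l b a) (hB : ∀ a b, T a b - T b a = ∑ l, d l (B l a b))
    (hC : ∑ i, T i i = ∑ l, d l (C l)) (hP : ∀ m, C m + ∑ j, B j m j = ∑ l, d l (P l m)) :
    ∃ k : Fin 3 → Fin 3 → M, (∀ i j, k i j = k j i) ∧ ∑ i, k i i = 0 ∧
      ∀ j, ∑ i, d i (k i j) = ∑ i, d i (T i j) := by
  let N : Fin 3 → Fin 3 → M := fun i j =>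
    (if i = j then (1 / 4 : ℝ) else 0) • (∑ m, P m m) - P i j
  let K : Fin 3 → Fin 3 → Fin 3 → Fin 3 → M := fun q l i j =>
    (if q = i then (1 : ℝ) else 0) • N l j + (if l = j then (1 : ℝ) else 0) • N q i -
      (if q = j then (1 : ℝ) else 0) • N l i - (if l = i then (1 : ℝ) else 0) • N q j
  let B' : Fin 3 → Fin 3 → Fin 3 → M := fun l i j => B l i j + ∑ q, d q (K q l i j)
  let A : Fin 3 → Fin 3 → Fin 3 → M := fun l i j =>
    (1 / 2 : ℝ) • (B' j l i - B' l i j - B' i j l)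
  have hK : ∀ q l i j, K q l i j = -K l q i j := fun q l i j => by simp only [K]; module
  have hK' : ∀ q l i j, K q l i j = -K q l j i := fun q l i j => by simp only [K]; module
  have hB' : ∀ l i j, B' l i j = -B' l j i := by
    intro l i j
    simp only [B']
    rw [hBanti l i j, neg_add, ← Finset.sum_neg_distrib]
    congr 1
    exact Finset.sum_congr rfl fun q _ => by rw [hK', map_neg]
  have hdivB' : ∀ i j, ∑ l, d l (B' l i j) = T i j - T j i := by
    intro i j
    simp only [B', map_add, Finset.sum_add_distrib, hB]
    rw [sum_sum_antisymm_eq_zero (A := fun q l => K q l i j) hd fun q l => hK q l i j, add_zero]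
  have hA : ∀ l i j, A l i j = -A i l j := by
    intro l i j
    simp only [A]
    rw [hB' j l i, hB' l i j, hB' i j l]
    module
  have hA' : ∀ l i j, A l i j - A l j i = -B' l i j := by
    intro l i j
    simp only [A]
    rw [hB' j l i, hB' l j i, hB' i l j]
    module
  refine ⟨fun i j => T i j + ∑ l, d l (A l i j), fun i j => ?_, ?_, fun j => ?_⟩
  · have h : ∑ l, d l (A l i j) - ∑ l, d l (A l j i) = -(T i j - T j i) := by
      rw [← hdivB', ← Finset.sum_sub_distrib, ← Finset.sum_neg_distrib]
      exact Finset.sum_congr rfl fun l _ => by rw [← map_sub, hA', map_neg]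
    rw [← sub_eq_zero, add_sub_add_comm, h, add_neg_cancel]
  · have := IsAddTorsionFree.of_isTorsionFree ℝ M
    have htr : ∀ l, ∑ i, A l i i = ∑ i, B' i l i := by
      intro l
      refine Finset.sum_congr rfl fun i _ => ?_
      have h0 : B' l i i = 0 := self_eq_neg.1 (hB' l i i)
      simp only [A]
      rw [h0, hB' i i l]
      module
    have hKtr : ∀ q l, ∑ i, K q i l i = -P q l := by
      intro q l
      fin_cases q <;> fin_cases l <;> simp [K, N, Fin.sum_univ_three] <;> module
    have hE : ∀ l, ∑ i, B' i l i = ∑ q, d q (P q l) - C l - ∑ q, d q (P q l) := by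
      intro l
      simp only [B', Finset.sum_add_distrib]
      rw [Finset.sum_comm, ← hP]
      simp only [← map_sum, hKtr, map_neg, Finset.sum_neg_distrib]
      rw [← hP]
      abel
    rw [Finset.sum_add_distrib, hC, Finset.sum_comm]
    simp only [← map_sum, htr, hE]
    simp
  · simp only [map_add, Finset.sum_add_distrib]
    rw [sum_sum_antisymm_eq_zero (A := fun l i => A l i j) hd fun l i => hA l i j, add_zero]

end TensorAlgebra

/-- Replace the `i`-th coordinate of `x` by `t`. -/
noncomputable def lineUpdate (i : Fin 3) (x : Space3) (t : ℝ) : Space3 :=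
  x + (t - x i) • EuclideanSpace.single i 1

lemma lineUpdate_apply (i j : Fin 3) (x : Space3) (t : ℝ) :
    lineUpdate i x t j = if j = i then t else x j := by
  by_cases h : j = i
  · subst h; simp [lineUpdate]
  · simp [lineUpdate, h]

lemma lineUpdate_congr {i : Fin 3} {x y : Space3} (h : ∀ j, j ≠ i → x j = y j) (t : ℝ) :
    lineUpdate i x t = lineUpdate i y t := by
  ext j
  by_cases hj : j = i <;> simp [lineUpdate_apply, hj, h]

lemma lineUpdate_lineUpdate (i : Fin 3) (x : Space3) (s t : ℝ) :
    lineUpdate i (lineUpdate i x s) t = lineUpdate i x t :=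
  lineUpdate_congr (fun j hj => by simp [lineUpdate_apply, hj]) t

lemma lineUpdate_self (i : Fin 3) (x : Space3) : lineUpdate i x (x i) = x := by
  simp [lineUpdate]

lemma contDiff_lineUpdate (i : Fin 3) :
    ContDiff ℝ (⊤ : ℕ∞) fun p : Space3 × ℝ => lineUpdate i p.1 p.2 := by
  unfold lineUpdate; fun_prop

/-- The closed cube with center `c` and half-side `r`. -/
def cube (c : Space3) (r : ℝ) : Set Space3 := {x | ∀ i, |x i - c i| ≤ r}

lemma cube_eq_preimage (c : Space3) {r : ℝ} (hr : 0 ≤ r) :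
    cube c r = (EuclideanSpace.equiv (Fin 3) ℝ).toHomeomorph ⁻¹'
      Metric.closedBall (EuclideanSpace.equiv (Fin 3) ℝ c) r := by
  ext x
  simp [cube, dist_pi_le_iff hr, Real.dist_eq]

lemma isCompact_cube (c : Space3) {r : ℝ} (hr : 0 ≤ r) : IsCompact (cube c r) := by
  rw [cube_eq_preimage c hr]
  exact (Homeomorph.isCompact_preimage _).2 (isCompact_closedBall _ _)

lemma cube_mem_nhds (c : Space3) {r : ℝ} (hr : 0 < r) : cube c r ∈ nhds c := by
  rw [cube_eq_preimage c hr.le]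
  exact (Homeomorph.continuous _).continuousAt.preimage_mem_nhds
    (Metric.closedBall_mem_nhds _ hr)

lemma exists_cube_subset {Ω : Set Space3} (hΩ : IsOpen Ω) {c : Space3} (hc : c ∈ Ω) :
    ∃ r, 0 < r ∧ cube c r ⊆ Ω := by
  let e := (EuclideanSpace.equiv (Fin 3) ℝ).toHomeomorph
  have h : e.symm ⁻¹' Ω ∈ nhds (e c) :=
    (hΩ.preimage e.symm.continuous).mem_nhds (by simpa using hc)
  obtain ⟨r, hr, hrs⟩ := Metric.nhds_basis_closedBall.mem_iff.1 h
  refine ⟨r, hr, fun x hx => ?_⟩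
  rw [cube_eq_preimage c hr.le] at hx
  have h : e.symm (e x) ∈ Ω := hrs hx
  rwa [e.symm_apply_apply] at h

/-- Smooth functions supported in the cube with center `c` and half-side `r`. -/
def IsCubeFunction (c : Space3) (r : ℝ) (g : Space3 → ℝ) : Prop :=
  ContDiff ℝ (⊤ : ℕ∞) g ∧ ∀ x, x ∉ cube c r → g x = 0

/-- The integral of `g` along the line through `x` in the `i`-th direction. -/
noncomputable def lineIntegral (i : Fin 3) (g : Space3 → ℝ) (x : Space3) : ℝ :=
  ∫ t, g (lineUpdate i x t)

/-- The primitive of `g` in the `i`-th direction which vanishes at `-∞`. -/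
noncomputable def linePrimitive (i : Fin 3) (g : Space3 → ℝ) (x : Space3) : ℝ :=
  ∫ t in Set.Iic (x i), g (lineUpdate i x t)

namespace IsCubeFunction

variable {c : Space3} {r : ℝ} {g : Space3 → ℝ}

lemma mem_testFunctions (hg : IsCubeFunction c r g) (hr : 0 ≤ r) {Ω : Set Space3}
    (h : cube c r ⊆ Ω) : g ∈ testFunctions Ω := by
  have hs : tsupport g ⊆ cube c r :=
    closure_minimal (fun x hx => by_contra fun h => hx (hg.2 x h)) (isCompact_cube c hr).isClosed
  exact ⟨hg.1, (isCompact_cube c hr).of_isClosed_subset (isClosed_tsupport g) hs, hs.trans h⟩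

lemma lineUpdate_eq_zero (hg : IsCubeFunction c r g) {i : Fin 3} {t : ℝ}
    (ht : t ∉ Set.Icc (c i - r) (c i + r)) (x : Space3) : g (lineUpdate i x t) = 0 := by
  refine hg.2 _ fun h => ht ?_
  have := abs_le.1 (h i)
  simp only [lineUpdate_apply, if_true] at this
  constructor <;> linarith [this.1, this.2]

lemma lineUpdate_eq_zero_of_ne (hg : IsCubeFunction c r g) {i j : Fin 3} (hj : j ≠ i)
    {x : Space3} (hx : r < |x j - c j|) (t : ℝ) : g (lineUpdate i x t) = 0 := by
  refine hg.2 _ fun h => hx.not_ge ?_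
  simpa [lineUpdate_apply, hj] using h j

lemma continuous_comp_lineUpdate (hg : IsCubeFunction c r g) (i : Fin 3) (x : Space3) :
    Continuous fun t => g (lineUpdate i x t) :=
  hg.1.continuous.comp ((contDiff_lineUpdate i).continuous.comp (Continuous.prodMk_right x))

lemma integrable_comp_lineUpdate (hg : IsCubeFunction c r g) (i : Fin 3) (x : Space3) :
    Integrable fun t => g (lineUpdate i x t) :=
  (hg.continuous_comp_lineUpdate i x).integrable_of_hasCompactSupport
    (HasCompactSupport.intro isCompact_Icc fun _ ht => hg.lineUpdate_eq_zero ht x)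

lemma contDiff_integral_mul (hg : IsCubeFunction c r g) (i : Fin 3) {H : ℝ → ℝ}
    (hH : LocallyIntegrable H) :
    ContDiff ℝ (⊤ : ℕ∞) fun x : Space3 => ∫ t, H (x i - t) * g (lineUpdate i x t) := by
  have h := contDiffOn_convolution_right_with_param_comp (μ := (volume : Measure ℝ)) (n := ⊤)
    (ContinuousLinearMap.mul ℝ ℝ) (s := Set.univ) (v := fun x : Space3 => x i)
    (contDiff_coord i).contDiffOn (f := H) (g := fun x t => g (lineUpdate i x t))
    isOpen_univ (isCompact_Icc (a := c i - r) (b := c i + r))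
    (fun x t _ ht => hg.lineUpdate_eq_zero ht x) hH
    (hg.1.comp (contDiff_lineUpdate i)).contDiffOn
  rw [contDiffOn_univ] at h
  convert h using 2 with x
  rw [convolution_eq_swap]
  rfl

lemma contDiff_lineIntegral (hg : IsCubeFunction c r g) (i : Fin 3) :
    ContDiff ℝ (⊤ : ℕ∞) (lineIntegral i g) := by
  simpa using! hg.contDiff_integral_mul i (H := fun _ => 1) (locallyIntegrable_const 1)

lemma contDiff_linePrimitive (hg : IsCubeFunction c r g) (i : Fin 3) :
    ContDiff ℝ (⊤ : ℕ∞) (linePrimitive i g) := by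
  have h := hg.contDiff_integral_mul i (H := (Set.Ici 0).indicator fun _ => 1)
    ((locallyIntegrable_const 1).indicator measurableSet_Ici)
  convert h using 2 with x
  rw [linePrimitive, ← integral_indicator measurableSet_Iic]
  congr 1 with t
  by_cases ht : t ≤ x i <;> simp [ht]

lemma pd_linePrimitive (hg : IsCubeFunction c r g) (i : Fin 3) :
    pd i (linePrimitive i g) = g := by
  ext x
  have hd : DifferentiableAt ℝ (linePrimitive i g) x :=
    (hg.contDiff_linePrimitive i).differentiable (by simp) x
  have h1 : HasDerivAt (fun s : ℝ => linePrimitive i g (x + s • EuclideanSpace.single i 1))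
      (pd i (linePrimitive i g) x) 0 :=
    (hd.hasFDerivAt.hasLineDerivAt (EuclideanSpace.single i 1))
  refine h1.unique ?_
  have h2 : ∀ s : ℝ, linePrimitive i g (x + s • EuclideanSpace.single i 1) =
      (∫ t in Set.Iic (x i), g (lineUpdate i x t)) +
        ∫ t in (x i)..(x i + s), g (lineUpdate i x t) := by
    intro s
    have hg_int := hg.integrable_comp_lineUpdate i x
    rw [← intervalIntegral.integral_Iic_sub_Iic hg_int.integrableOn hg_int.integrableOn,
      add_sub_cancel, linePrimitive]
    have hx : (x + s • EuclideanSpace.single i (1 : ℝ)) i = x i + s := by simp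
    rw [hx]
    refine integral_congr_ae (Filter.Eventually.of_forall fun t => ?_)
    exact congrArg g (lineUpdate_congr (fun j hj => by simp [hj]) t)
  simp_rw [h2]
  have hc := hg.continuous_comp_lineUpdate i x
  have h3 : HasDerivAt (fun u => ∫ t in (x i)..u, g (lineUpdate i x t))
      (g (lineUpdate i x (x i + 0))) (x i + 0) :=
    intervalIntegral.integral_hasDerivAt_right (hc.intervalIntegrable _ _)
      hc.aestronglyMeasurable.stronglyMeasurableAtFilter hc.continuousAt
  have h4 := (h3.comp_const_add (x i) 0).const_add (∫ t in Set.Iic (x i), g (lineUpdate i x t))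
  simpa [lineUpdate_self] using h4

lemma linePrimitive (hg : IsCubeFunction c r g) {i : Fin 3} (h0 : ∀ x, lineIntegral i g x = 0) :
    IsCubeFunction c r (linePrimitive i g) := by
  refine ⟨hg.contDiff_linePrimitive i, fun x hx => ?_⟩
  simp only [cube, Set.mem_ofPred_eq, not_forall, not_le] at hx
  obtain ⟨j, hj⟩ := hx
  by_cases hji : j = i
  · subst hji
    rcases lt_abs.1 hj with h | h
    · rw [_root_.linePrimitive, ← h0 x, lineIntegral]
      refine setIntegral_eq_integral_of_forall_compl_eq_zero fun t ht => ?_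
      refine hg.lineUpdate_eq_zero (fun h' => ht ?_) x
      exact h'.2.trans (by linarith)
    · refine setIntegral_eq_zero_of_forall_eq_zero fun t ht => ?_
      refine hg.lineUpdate_eq_zero (fun h' => ?_) x
      linarith [h'.1, Set.mem_Iic.1 ht]
  · simp [_root_.linePrimitive, hg.lineUpdate_eq_zero_of_ne hji hj]

lemma mul_lineIntegral (hg : IsCubeFunction c r g) {i : Fin 3} {ρ : ℝ → ℝ}
    (hρ : ContDiff ℝ (⊤ : ℕ∞) ρ) (hρ0 : ∀ t, r < |t - c i| → ρ t = 0) :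
    IsCubeFunction c r fun x => ρ (x i) * lineIntegral i g x := by
  refine ⟨(hρ.comp (contDiff_coord i)).mul (hg.contDiff_lineIntegral i), fun x hx => ?_⟩
  simp only [cube, Set.mem_ofPred_eq, not_forall, not_le] at hx
  obtain ⟨j, hj⟩ := hx
  by_cases hji : j = i
  · subst hji
    simp [hρ0 _ hj]
  · simp [lineIntegral, hg.lineUpdate_eq_zero_of_ne hji hj]

lemma sub_mul_lineIntegral_mem (hg : IsCubeFunction c r g) (hr : 0 ≤ r) {Ω : Set Space3}
    (hΩ : cube c r ⊆ Ω) {i : Fin 3} {ρ : ℝ → ℝ} (hρ : ContDiff ℝ (⊤ : ℕ∞) ρ)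
    (hρ0 : ∀ t, r < |t - c i| → ρ t = 0) (hρ1 : ∫ t, ρ t = 1) :
    (g - fun x => ρ (x i) * lineIntegral i g x) ∈
      LinearMap.range (testFunctions.divergence Ω) := by
  have hm := hg.mul_lineIntegral hρ hρ0
  have hs : IsCubeFunction c r (g - fun x => ρ (x i) * lineIntegral i g x) :=
    ⟨hg.1.sub hm.1, fun x hx => by simp only [Pi.sub_apply, hg.2 x hx, hm.2 x hx, sub_zero]⟩
  have h0 : ∀ x, lineIntegral i (g - fun x => ρ (x i) * lineIntegral i g x) x = 0 := by
    intro x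
    rw [lineIntegral]
    simp only [Pi.sub_apply]
    rw [integral_sub (hg.integrable_comp_lineUpdate i x) (hm.integrable_comp_lineUpdate i x)]
    simp [lineIntegral, lineUpdate_apply, lineUpdate_lineUpdate, integral_mul_const, hρ1]
  rw [← hs.pd_linePrimitive i]
  exact testFunctions.pd_mem_range_divergence i ((hs.linePrimitive h0).mem_testFunctions hr hΩ)

/-- A smooth function with vanishing integral supported in a cube is the divergence of smooth
functions supported in the same cube. -/
lemma mem_range_divergence (hg : IsCubeFunction c r g) (hr : 0 < r) {Ω : Set Space3}
    (hΩ : cube c r ⊆ Ω) (hg_int : ∫ x, g x = 0) :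
    g ∈ LinearMap.range (testFunctions.divergence Ω) := by
  let b : ∀ i : Fin 3, ContDiffBump (c i) := fun i => ⟨r / 2, r, by linarith, by linarith⟩
  let ρ : Fin 3 → ℝ → ℝ := fun i => (b i).normed volume
  have hρ : ∀ i, ContDiff ℝ (⊤ : ℕ∞) (ρ i) := fun i => (b i).contDiff_normed
  have hρ0 : ∀ i t, r < |t - c i| → ρ i t = 0 := by
    intro i t ht
    refine Function.notMem_support.1 fun h => ?_
    rw [(b i).support_normed_eq] at h
    exact ht.not_gt (by simpa [Real.dist_eq] using h)
  have hρ1 : ∀ i, ∫ t, ρ i t = 1 := fun i => (b i).integral_normed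
  let η : Space3 → ℝ := fun x => ρ 2 (x 2) * (ρ 1 (x 1) * ρ 0 (x 0))
  have hη : IsCubeFunction c r η := by
    refine ⟨((hρ 2).comp (contDiff_coord 2)).mul (((hρ 1).comp (contDiff_coord 1)).mul
      ((hρ 0).comp (contDiff_coord 0))), fun x hx => ?_⟩
    simp only [cube, Set.mem_ofPred_eq, not_forall, not_le] at hx
    obtain ⟨j, hj⟩ := hx
    have := hρ0 j _ hj
    fin_cases j <;> simp_all [η]
  have hηpos : 0 < ∫ x, η x := by
    refine hη.1.continuous.integral_pos_of_hasCompactSupport_nonneg_nonzero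
      (hη.mem_testFunctions hr.le subset_rfl).2.1 (fun x => ?_) (x := c) ?_
    · have := fun i => (b i).nonneg_normed (μ := volume) (x i)
      exact mul_nonneg (this 2) (mul_nonneg (this 1) (this 0))
    · have : ∀ i, ρ i (c i) ≠ 0 := by
        intro i
        rw [← Function.mem_support, (b i).support_normed_eq]
        simpa using hr
      exact mul_ne_zero (this 2) (mul_ne_zero (this 1) (this 0))
  have hg1 := hg.mul_lineIntegral (hρ 0) (hρ0 0)
  have hg2 := hg1.mul_lineIntegral (hρ 1) (hρ0 1)
  have hmem := add_mem (add_mem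
    (hg.sub_mul_lineIntegral_mem hr.le hΩ (hρ 0) (hρ0 0) (hρ1 0))
    (hg1.sub_mul_lineIntegral_mem hr.le hΩ (hρ 1) (hρ0 1) (hρ1 1)))
    (hg2.sub_mul_lineIntegral_mem hr.le hΩ (hρ 2) (hρ0 2) (hρ1 2))
  rw [sub_add_sub_cancel, sub_add_sub_cancel] at hmem
  let I : ℝ := ∫ t₂, ∫ t₁, ∫ t₀,
    g (lineUpdate 0 (lineUpdate 1 (lineUpdate 2 0 t₂) t₁) t₀)
  have hI : (fun x : Space3 => ρ 2 (x 2) * lineIntegral 2 (fun x => ρ 1 (x 1) *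
      lineIntegral 1 (fun x => ρ 0 (x 0) * lineIntegral 0 g x) x) x) = I • η := by
    ext x
    have hx : ∀ t₂ t₁ t₀, lineUpdate 0 (lineUpdate 1 (lineUpdate 2 x t₂) t₁) t₀ =
        lineUpdate 0 (lineUpdate 1 (lineUpdate 2 0 t₂) t₁) t₀ := by
      intro t₂ t₁ t₀
      ext j
      fin_cases j <;> simp [lineUpdate_apply]
    simp [lineIntegral, lineUpdate_apply, integral_const_mul, hx, I, η]
    ring
  rw [hI] at hmem
  have h0 := testFunctions.integral_eq_zero_of_mem_range_divergence hmem
  simp only [Pi.sub_apply, Pi.smul_apply, smul_eq_mul] at h0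
  rw [integral_sub (testFunctions.integrable (hg.mem_testFunctions hr.le hΩ))
    ((testFunctions.integrable (hη.mem_testFunctions hr.le hΩ)).const_mul I), hg_int,
    integral_const_mul, zero_sub, neg_eq_zero, mul_eq_zero] at h0
  rcases h0 with h0 | h0
  · simpa [h0] using hmem
  · exact absurd h0 hηpos.ne'

end IsCubeFunction

namespace testFunctions

variable {Ω : Set Space3} {g : Space3 → ℝ}

/-- A linear functional that vanishes on divergences is represented, on each cube, by
integration against a constant. -/
lemma exists_eq_mul_integral {lam : (Space3 → ℝ) →ₗ[ℝ] ℝ}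
    (hlam : LinearMap.range (divergence Ω) ≤ LinearMap.ker lam) {c : Space3} {r : ℝ} (hr : 0 < r)
    (hc : cube c r ⊆ Ω) :
    ∃ a : ℝ, ∀ h, IsCubeFunction c r h → lam h = a * ∫ x, h x := by
  obtain ⟨b, hbs, hbc, hb, hbr, hb1⟩ :=
    exists_contDiff_tsupport_subset (n := ⊤) (cube_mem_nhds c hr)
  have hbcube : IsCubeFunction c r b :=
    ⟨hb, fun x hx => image_eq_zero_of_notMem_tsupport fun h => hx (hbs h)⟩
  have hpos : 0 < ∫ x, b x :=
    hb.continuous.integral_pos_of_hasCompactSupport_nonneg_nonzero hbc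
      (fun x => (hbr ⟨x, rfl⟩).1) (x := c) (by simp [hb1])
  refine ⟨lam b / ∫ x, b x, fun h hh => ?_⟩
  set s : ℝ := (∫ x, h x) / ∫ x, b x with hs
  have hsub : IsCubeFunction c r (h - s • b) :=
    ⟨hh.1.sub (contDiff_const.smul hb), fun x hx => by simp [hh.2 x hx, hbcube.2 x hx]⟩
  have h0 : ∫ x, (h - s • b) x = 0 := by
    simp only [Pi.sub_apply, Pi.smul_apply, smul_eq_mul]
    rw [integral_sub (integrable (hh.mem_testFunctions hr.le hc))
      ((integrable (hbcube.mem_testFunctions hr.le hc)).const_mul s), integral_const_mul, hs,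
      div_mul_cancel₀ _ hpos.ne', sub_self]
  have hker : lam (h - s • b) = 0 := hlam (hsub.mem_range_divergence hr hc h0)
  rw [map_sub, map_smul, sub_eq_zero] at hker
  rw [hker, hs, smul_eq_mul]
  ring

/-- A test function orthogonal to all locally constant functions on `Ω` is the divergence of a
triple of test functions. -/
theorem mem_range_divergence (hΩ : IsOpen Ω) (hg : g ∈ testFunctions Ω)
    (horth : ∀ φ, LocallyConstantOn φ Ω → ∫ x, φ x * g x = 0) :
    g ∈ LinearMap.range (divergence Ω) := by
  by_contra hmem
  obtain ⟨lam, hne, hlam⟩ := Submodule.exists_le_ker_of_notMem hmem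
  choose! r hr hrΩ using fun (c : Space3) (hc : c ∈ Ω) => exists_cube_subset hΩ hc
  choose! φ hφ using fun (c : Space3) (hc : c ∈ Ω) =>
    exists_eq_mul_integral hlam (hr c hc) (hrΩ c hc)
  have hconst : ∀ x ∈ Ω, ∀ y ∈ interior (cube x (r x)), φ y = φ x := by
    intro x hx y hy
    have hyΩ : y ∈ Ω := hrΩ x hx (interior_subset hy)
    have hnhds : cube x (r x) ∩ cube y (r y) ∈ nhds y :=
      Filter.inter_mem (mem_interior_iff_mem_nhds.1 hy) (cube_mem_nhds y (hr y hyΩ))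
    obtain ⟨b, hbs, hbc, hb, hbr, hb1⟩ := exists_contDiff_tsupport_subset (n := ⊤) hnhds
    have hpos : 0 < ∫ x, b x :=
      hb.continuous.integral_pos_of_hasCompactSupport_nonneg_nonzero hbc
        (fun x => (hbr ⟨x, rfl⟩).1) (x := y) (by simp [hb1])
    have h1 := hφ x hx b
      ⟨hb, fun z hz => image_eq_zero_of_notMem_tsupport fun h => hz (hbs h).1⟩
    have h2 := hφ y hyΩ b
      ⟨hb, fun z hz => image_eq_zero_of_notMem_tsupport fun h => hz (hbs h).2⟩
    exact mul_right_cancel₀ hpos.ne' (h2.symm.trans h1)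
  have hφΩ : LocallyConstantOn φ Ω := fun x hx =>
    Filter.eventually_of_mem (interior_mem_nhds.2 (cube_mem_nhds x (hr x hx))) (hconst x hx)
  obtain ⟨t, ht, htcover⟩ := hg.2.1.elim_nhds_subcover (fun x => interior (cube x (r x)))
    fun x hx => interior_mem_nhds.2 (cube_mem_nhds x (hr x (hg.2.2 hx)))
  obtain ⟨ψ, hψ⟩ := SmoothPartitionOfUnity.exists_isSubordinate (modelWithCornersSelf ℝ Space3)
    (isClosed_tsupport g) (fun i : t => interior (cube (i : Space3) (r i)))
    (fun _ => isOpen_interior) (fun x hx => by simpa using htcover hx)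
  have hψcube : ∀ i : t, IsCubeFunction (i : Space3) (r i) (⇑(ψ i) * g) := fun i =>
    ⟨(ψ i).contMDiff.contDiff.mul hg.1, fun x hx => by
      have h0 : ψ i x = 0 := image_eq_zero_of_notMem_tsupport fun h =>
        hx (interior_subset (hψ i h))
      simp [h0]⟩
  have hsum : ∑ i : t, ⇑(ψ i) * g = g := by
    ext x
    rw [Finset.sum_apply]
    simp only [Pi.mul_apply]
    rw [← Finset.sum_mul]
    by_cases hx : x ∈ tsupport g
    · have h1 := ψ.sum_eq_one hx
      rw [finsum_eq_sum_of_fintype] at h1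
      rw [h1, one_mul]
    · rw [image_eq_zero_of_notMem_tsupport hx, mul_zero]
  have hpiece : ∀ i : t, lam (⇑(ψ i) * g) = ∫ x, φ x * (ψ i x * g x) := by
    intro i
    rw [hφ i (hg.2.2 (ht i i.2)) _ (hψcube i), ← integral_const_mul]
    refine integral_congr_ae (Filter.Eventually.of_forall fun x => ?_)
    by_cases hx : x ∈ tsupport (ψ i)
    · simp [hconst i (hg.2.2 (ht i i.2)) x (hψ i hx)]
    · simp [image_eq_zero_of_notMem_tsupport hx]
  refine hne ?_
  rw [← horth φ hφΩ]
  conv_lhs => rw [← hsum]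
  rw [map_sum]
  simp only [hpiece]
  rw [← integral_finsetSum]
  · refine integral_congr_ae (Filter.Eventually.of_forall fun x => ?_)
    have h := congrFun hsum x
    simp only [Finset.sum_apply, Pi.mul_apply] at h
    simp only [← Finset.mul_sum, h]
  · intro i _
    exact integrable (hφΩ.mul_mem (mul_mem (ψ i).contMDiff.contDiff hg))

lemma exists_eq_sum_partialDeriv (hΩ : IsOpen Ω) (g : testFunctions Ω)
    (h : ∀ φ, ∀ hφ : LocallyConstantOn φ Ω, hφ.weightedIntegral g = 0) :
    ∃ u : Fin 3 → testFunctions Ω, g = ∑ i, partialDeriv Ω i (u i) := by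
  obtain ⟨u, hu⟩ := mem_range_divergence hΩ g.2 h
  refine ⟨u, Subtype.ext ?_⟩
  rw [← hu]
  simp [divergence]

end testFunctions

/-- The conformal Killing equation for the vector field with components `W j`. -/
def IsConformalKilling (W : Fin 3 → Space3 → ℝ) : Prop :=
  ∀ x i j, pd i (W j) x + pd j (W i) x =
    2 / 3 * (∑ l, pd l (W l) x) * (if i = j then 1 else 0)

lemma pd_const_smul_coord (i m : Fin 3) (s : ℝ) (x : Space3) :
    pd i (s • coord m) x = s * if i = m then 1 else 0 := by
  rw [pd_smul, Pi.smul_apply, pd_coord, smul_eq_mul]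

lemma pd_coord_mul_coord (i m n : Fin 3) :
    pd i (coord m * coord n) =
      fun x => x m * (if i = n then 1 else 0) + x n * (if i = m then 1 else 0) := by
  rw [pd_mul i ((contDiff_coord m).differentiable (by simp))
    ((contDiff_coord n).differentiable (by simp)), pd_coord, pd_coord]
  rfl

lemma isConformalKilling_translation (a : Fin 3) :
    IsConformalKilling fun j _ => if j = a then 1 else 0 := by
  intro x i j
  simp [pd]

lemma isConformalKilling_rotation (a b : Fin 3) :
    IsConformalKilling fun j => (if j = b then (1 : ℝ) else 0) • coord a +
      (-if j = a then (1 : ℝ) else 0) • coord b := by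
  have hd : ∀ m (s : ℝ), Differentiable ℝ (s • coord m) := fun m s =>
    ((contDiff_coord m).differentiable (by simp)).const_smul s
  intro x i j
  simp only [pd_add _ (hd _ _) (hd _ _), Pi.add_apply, pd_const_smul_coord]
  fin_cases a <;> fin_cases b <;> fin_cases i <;> fin_cases j <;> simp [Fin.sum_univ_three]

lemma isConformalKilling_dilation : IsConformalKilling coord := by
  intro x i j
  simp only [pd_coord]
  by_cases h : i = j
  · simp [h]; norm_num
  · simp [h, Ne.symm h]

lemma isConformalKilling_specialConformal (m : Fin 3) :
    IsConformalKilling fun j => (2 : ℝ) • (coord m * coord j) +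
      (-if j = m then (1 : ℝ) else 0) • ∑ i, coord i * coord i := by
  have hm : ∀ a b, Differentiable ℝ (coord a * coord b) := fun a b =>
    ((contDiff_coord a).differentiable (by simp)).mul ((contDiff_coord b).differentiable (by simp))
  intro x i j
  simp only [Fin.sum_univ_three (fun i => coord i * coord i),
    pd_add _ ((hm _ _).const_smul _) ((((hm _ _).add (hm _ _)).add (hm _ _)).const_smul _),
    pd_smul, pd_add _ ((hm _ _).add (hm _ _)) (hm _ _), pd_add _ (hm _ _) (hm _ _),
    pd_coord_mul_coord, Pi.add_apply, Pi.smul_apply, smul_eq_mul]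
  fin_cases m <;> fin_cases i <;> fin_cases j <;> simp [Fin.sum_univ_three] <;> ring

lemma integral_eq_zero_of_isConformalKilling {Ω : Set Space3} {f : Space3 → Space3}
    (hfΩ : tsupport f ⊆ Ω)
    (horth : ∀ V : Space3 → Space3, ContDiffOn ℝ (⊤ : ℕ∞) V Ω →
      (∀ x ∈ Ω, ∀ i j : Fin 3, pd i (fun y => V y j) x + pd j (fun y => V y i) x =
        2 / 3 * (∑ l, pd l (fun y => V y l) x) * (if i = j then 1 else 0)) →
      ∫ x in Ω, ⟪V x, f x⟫_ℝ = 0)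
    {W : Fin 3 → Space3 → ℝ} (hW : ∀ j, ContDiff ℝ (⊤ : ℕ∞) (W j)) (hWK : IsConformalKilling W)
    {φ : Space3 → ℝ} (hφ : LocallyConstantOn φ Ω) :
    ∫ x, φ x * ∑ j, W j x * f x j = 0 := by
  have h := horth (fun x => WithLp.toLp 2 fun j => φ x * W j x) ?_ ?_
  · rw [setIntegral_eq_integral_of_forall_compl_eq_zero] at h
    · rw [← h]
      congr 1 with x
      simp only [PiLp.inner_apply, Finset.mul_sum, RCLike.inner_apply, conj_trivial]
      exact Finset.sum_congr rfl fun j _ => by ring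
    · intro x hx
      simp [image_eq_zero_of_notMem_tsupport fun h => hx (hfΩ h)]
  · refine contDiffOn_piLp' 2 fun j x hx => ?_
    exact ((hφ.contDiffAt hx).mul (hW j).contDiffAt).contDiffWithinAt
  · intro x hx i j
    simp only [hφ.pd_mul hx, ← mul_add, hWK x i j, ← Finset.mul_sum]
    ring

lemma LocallyConstantOn.weightedIntegral_mulCoord_mulCoord_partialDeriv {Ω : Set Space3}
    {φ : Space3 → ℝ} (hφ : LocallyConstantOn φ Ω) (m n i : Fin 3) (g : testFunctions Ω) :
    hφ.weightedIntegral (testFunctions.mulCoord Ω m (testFunctions.mulCoord Ω n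
      (testFunctions.partialDeriv Ω i g))) =
      -((if i = n then 1 else 0) * hφ.weightedIntegral (testFunctions.mulCoord Ω m g)) -
        (if i = m then 1 else 0) * hφ.weightedIntegral (testFunctions.mulCoord Ω n g) := by
  have h := hφ.weightedIntegral_mulCoord_partialDeriv m i (testFunctions.mulCoord Ω n g)
  rw [testFunctions.partialDeriv_mulCoord, map_add, map_smul, map_add, map_smul, smul_eq_mul] at h
  linarith

/-- Delay's theorem, Euclidean case. If `f : ℝ³ → ℝ³` is smooth with
compact support in a bounded smooth domain `Ω` and is `L²(Ω)`-orthogonal to all conformal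
Killing fields on `Ω`, then `f = δk` for a smooth trace-free symmetric 2-tensor `k`
supported in the closure of `Ω`, where `(δk)_j = -∂_i k_{ij}`. -/
theorem stmt_13 (Ω : Set (EuclideanSpace ℝ (Fin 3))) (hne : Ω.Nonempty)
    (hop : IsOpen Ω) (hbd : Bornology.IsBounded Ω) (hsm : HasSmoothBoundary Ω)
    (f : EuclideanSpace ℝ (Fin 3) → EuclideanSpace ℝ (Fin 3))
    (hf : ContDiff ℝ (⊤ : ℕ∞) f) (hfc : HasCompactSupport f) (hfΩ : tsupport f ⊆ Ω)
    (horth : ∀ V : EuclideanSpace ℝ (Fin 3) → EuclideanSpace ℝ (Fin 3),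
      ContDiffOn ℝ (⊤ : ℕ∞) V Ω →
      (∀ x ∈ Ω, ∀ i j : Fin 3,
        pd i (fun y => V y j) x + pd j (fun y => V y i) x =
          2 / 3 * (∑ l, pd l (fun y => V y l) x) * (if i = j then 1 else 0)) →
      ∫ x in Ω, ⟪V x, f x⟫_ℝ = 0) :
    ∃ k : EuclideanSpace ℝ (Fin 3) → Fin 3 → Fin 3 → ℝ,
      ContDiff ℝ (⊤ : ℕ∞) k ∧
      (∀ x i j, k x i j = k x j i) ∧
      (∀ x, ∑ i, k x i i = 0) ∧
      Function.support k ⊆ closure Ω ∧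
      ∀ (x : EuclideanSpace ℝ (Fin 3)) (j : Fin 3),
        -(∑ i, pd i (fun y => k y i j) x) = f x j := by
  have hfj : ∀ j, (fun x => f x j) ∈ testFunctions Ω := fun j =>
    ⟨contDiff_euclidean.1 hf j, hfc.comp_left (g := fun v : Space3 => v j) rfl,
      (tsupport_comp_subset (g := fun v : Space3 => v j) rfl f).trans hfΩ⟩
  let F : Fin 3 → testFunctions Ω := fun j => ⟨fun x => f x j, hfj j⟩
  let D := testFunctions.partialDeriv Ω
  let X := testFunctions.mulCoord Ω
  have hK : ∀ W : Fin 3 → Space3 → ℝ, (∀ j, ContDiff ℝ (⊤ : ℕ∞) (W j)) → IsConformalKilling W →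
      ∀ φ, LocallyConstantOn φ Ω → ∫ x, φ x * ∑ j, W j x * f x j = 0 :=
    fun W hW hWK φ hφ => integral_eq_zero_of_isConformalKilling hfΩ horth hW hWK hφ
  have htrans : ∀ a φ, ∀ hφ : LocallyConstantOn φ Ω, hφ.weightedIntegral (F a) = 0 := by
    intro a φ hφ
    simpa using! hK _ (fun _ => contDiff_const) (isConformalKilling_translation a) φ hφ
  have hrot : ∀ a b φ, ∀ hφ : LocallyConstantOn φ Ω,
      hφ.weightedIntegral (X a (F b) - X b (F a)) = 0 := by
    intro a b φ hφ
    rw [← hK _ (fun j => (contDiff_const.smul (contDiff_coord a)).add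
      (contDiff_const.smul (contDiff_coord b))) (isConformalKilling_rotation a b) φ hφ]
    change ∫ x, φ x * (x a * f x b - x b * f x a) = _
    congr 1 with x
    simp [coord, add_mul, Finset.sum_add_distrib, sub_eq_add_neg]
  have hdil : ∀ φ, ∀ hφ : LocallyConstantOn φ Ω,
      hφ.weightedIntegral (∑ j, X j (F j)) = 0 := by
    intro φ hφ
    rw [← hK _ contDiff_coord isConformalKilling_dilation φ hφ]
    change ∫ x, φ x * (((∑ j, X j (F j) : testFunctions Ω)) : Space3 → ℝ) x = _
    congr 1 with x
  have hspec : ∀ m φ, ∀ hφ : LocallyConstantOn φ Ω,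
      hφ.weightedIntegral (∑ j, ((2 : ℝ) • X m (X j (F j)) - X j (X j (F m)))) = 0 := by
    intro m φ hφ
    rw [← hK _ (fun j => by
        have h i j := (contDiff_coord i).mul (contDiff_coord j)
        rw [Fin.sum_univ_three]
        exact (contDiff_const.smul (h m j)).add (contDiff_const.smul (((h 0 0).add (h 1 1)).add
          (h 2 2))))
      (isConformalKilling_specialConformal m) φ hφ]
    change ∫ x, φ x * (((∑ j, ((2 : ℝ) • X m (X j (F j)) - X j (X j (F m))) :
      testFunctions Ω)) : Space3 → ℝ) x = _
    congr 1 with x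
    rw [Submodule.coe_sum, Finset.sum_apply]
    have hx : ∀ j, (((2 : ℝ) • X m (X j (F j)) - X j (X j (F m)) : testFunctions Ω) :
        Space3 → ℝ) x = 2 * (x m * (x j * f x j)) - x j * (x j * f x m) := fun _ => rfl
    simp only [hx]
    congr 1
    fin_cases m <;> simp [coord, Fin.sum_univ_three] <;> ring
  choose T hT using fun j => testFunctions.exists_eq_sum_partialDeriv hop (F j) (htrans j)
  have hXF : ∀ φ, ∀ hφ : LocallyConstantOn φ Ω, ∀ a b,
      hφ.weightedIntegral (X a (F b)) = -hφ.weightedIntegral (T b a) := by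
    intro φ hφ a b
    rw [hT b]
    simp [X, hφ.weightedIntegral_mulCoord_partialDeriv]
  have hXXF : ∀ φ, ∀ hφ : LocallyConstantOn φ Ω, ∀ m n b,
      hφ.weightedIntegral (X m (X n (F b))) =
        -hφ.weightedIntegral (X m (T b n)) - hφ.weightedIntegral (X n (T b m)) := by
    intro φ hφ m n b
    rw [hT b]
    simp [X, hφ.weightedIntegral_mulCoord_mulCoord_partialDeriv]
  choose B hB using fun a b => testFunctions.exists_eq_sum_partialDeriv hop (T b a - T a b)
    fun φ hφ => by
      have h := hrot a b φ hφ
      rw [map_sub, hXF, hXF] at h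
      rw [map_sub]
      linarith
  obtain ⟨C, hC⟩ := testFunctions.exists_eq_sum_partialDeriv hop (∑ i, T i i) fun φ hφ => by
    have h := hdil φ hφ
    simpa [hXF] using h
  let B' : Fin 3 → Fin 3 → Fin 3 → testFunctions Ω := fun l a b =>
    (1 / 2 : ℝ) • (B a b l - B b a l)
  have hB' : ∀ a b, T b a - T a b = ∑ l, D l (B' l a b) := by
    intro a b
    simp only [B', map_smul, map_sub, ← Finset.smul_sum, Finset.sum_sub_distrib, D]
    rw [← hB, ← hB]
    module
  choose P hP using fun m => testFunctions.exists_eq_sum_partialDeriv hop (C m + ∑ j, B' j m j)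
    fun φ hφ => by
      have h := hspec m φ hφ
      have h1 : hφ.weightedIntegral (X m (∑ i, T i i)) = -hφ.weightedIntegral (C m) := by
        rw [hC]
        simp [X, hφ.weightedIntegral_mulCoord_partialDeriv]
      have h2 : ∀ j, hφ.weightedIntegral (X j (T j m)) - hφ.weightedIntegral (X j (T m j)) =
          -hφ.weightedIntegral (B' j m j) := by
        intro j
        rw [← map_sub, ← map_sub, hB']
        simp [X, D, hφ.weightedIntegral_mulCoord_partialDeriv]
      simp only [map_sub, map_smul, hXXF, smul_eq_mul, Fin.sum_univ_three,
        map_add] at h h1 ⊢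
      linarith [h2 0, h2 1, h2 2]
  obtain ⟨k, hksymm, hktr, hkdiv⟩ := exists_symm_traceFree_div_eq (d := D)
    (T := fun i j => T j i) (P := fun l m => P m l) (B := B') (C := C)
    testFunctions.partialDeriv_comm (fun l a b => by simp only [B']; module) hB' hC hP
  refine ⟨fun x i j => -(k i j : Space3 → ℝ) x, ?_, fun x i j => by simp only [hksymm i j],
    fun x => ?_, ?_, fun x j => ?_⟩
  · exact contDiff_pi.2 fun i => contDiff_pi.2 fun j => (k i j).2.1.neg
  · have h := congrFun (congrArg Subtype.val hktr) x
    rw [Submodule.coe_sum, Finset.sum_apply] at h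
    rw [Finset.sum_neg_distrib, h]
    simp
  · intro x hx
    by_contra hxΩ
    refine hx (funext fun i => funext fun j => ?_)
    have h0 : (k i j : Space3 → ℝ) x = 0 :=
      image_eq_zero_of_notMem_tsupport fun h => hxΩ (subset_closure ((k i j).2.2.2 h))
    simp [h0]
  · have h := congrFun (congrArg Subtype.val ((hkdiv j).trans (hT j).symm)) x
    rw [Submodule.coe_sum, Finset.sum_apply] at h
    rw [← Finset.sum_neg_distrib]
    refine Eq.trans (Finset.sum_congr rfl fun i _ => ?_) h
    simp [pd, D, testFunctions.partialDeriv]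
end

section
/- Let Λ > 0 and 𝔪, a ∈ ℝ. Fix r₀ > 0 and θ₀ ∈ (0, π), and set Δ_r = (r₀² + a²)(1 − Λr₀²/3) − 2𝔪r₀, Δ_r⁰ = (r₀² + a²)(1 − Λr₀²/3), Δ_θ = 1 + (Λ/3)a² cos²θ₀, Δ₀ = 1 + (Λ/3)a², and ρ² = r₀² + a² cos²θ₀, and assume Δ_r ≠ 0 and Δ_r⁰ ≠ 0. Then for all (T, R, Θ, Φ) ∈ ℝ⁴: −(Δ_r/ρ²)(T − (a sin²θ₀/Δ₀)Φ)² + (ρ²/Δ_r)R² + (ρ²/Δ_θ)Θ² + sin²θ₀ (Δ_θ/ρ²)(aT − ((r₀²+a²)/Δ₀)Φ)² = [ ((Λ/3)(r₀² + a² sin²θ₀) − 1)T² + (ρ²/Δ_r⁰)R² + (ρ²/Δ_θ)Θ² − (2Λ/3) a ((r₀²+a²)/Δ₀) sin²θ₀ · TΦ + ((r₀²+a²)/Δ₀) sin²θ₀ · Φ² ] + [ (2𝔪r₀/ρ²)(T − (a sin²θ₀/Δ₀)Φ)² + (2𝔪r₀ρ²/(Δ_r⁰ Δ_r))R² ]. 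-/
open Real

/-- The Kerr–de Sitter metric in Boyer–Lindquist coordinates decomposes
as `g_{𝔪,a} = g_{dS} + c_{𝔪,a}`, where `g_{dS}` is the de Sitter metric in rotating
oblate coordinates and
`c_{𝔪,a} = (2𝔪r₀/ρ²)(dt₀ - (a sin²θ₀/Δ₀)dφ₀)² + (2𝔪r₀ρ²/(Δ_r⁰Δ_r))dr₀²`,
as an identity of quadratic forms on the coordinate differentials `(T, R, Θ, Φ)`. -/
theorem stmt_15 (Λ m a r₀ θ₀ : ℝ) (hΛ : 0 < Λ) (hr₀ : 0 < r₀)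
    (hθ₀ : θ₀ ∈ Set.Ioo (0 : ℝ) π)
    (Δr ΔrZ Δθ Δ0 ρ2 : ℝ)
    (hΔr : Δr = (r₀ ^ 2 + a ^ 2) * (1 - Λ * r₀ ^ 2 / 3) - 2 * m * r₀)
    (hΔrZ : ΔrZ = (r₀ ^ 2 + a ^ 2) * (1 - Λ * r₀ ^ 2 / 3))
    (hΔθ : Δθ = 1 + Λ / 3 * a ^ 2 * cos θ₀ ^ 2)
    (hΔ0 : Δ0 = 1 + Λ / 3 * a ^ 2)
    (hρ2 : ρ2 = r₀ ^ 2 + a ^ 2 * cos θ₀ ^ 2)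
    (hΔr0 : Δr ≠ 0) (hΔrZ0 : ΔrZ ≠ 0) :
    ∀ T R Θ Φ : ℝ,
      -(Δr / ρ2) * (T - a * sin θ₀ ^ 2 / Δ0 * Φ) ^ 2 + ρ2 / Δr * R ^ 2 +
          ρ2 / Δθ * Θ ^ 2 +
          sin θ₀ ^ 2 * (Δθ / ρ2) * (a * T - (r₀ ^ 2 + a ^ 2) / Δ0 * Φ) ^ 2 =
        ((Λ / 3 * (r₀ ^ 2 + a ^ 2 * sin θ₀ ^ 2) - 1) * T ^ 2 + ρ2 / ΔrZ * R ^ 2 +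
            ρ2 / Δθ * Θ ^ 2 -
            2 * Λ / 3 * a * ((r₀ ^ 2 + a ^ 2) / Δ0) * sin θ₀ ^ 2 * (T * Φ) +
            (r₀ ^ 2 + a ^ 2) / Δ0 * sin θ₀ ^ 2 * Φ ^ 2) +
          (2 * m * r₀ / ρ2 * (T - a * sin θ₀ ^ 2 / Δ0 * Φ) ^ 2 +
            2 * m * r₀ * ρ2 / (ΔrZ * Δr) * R ^ 2) := by
  intro T R Θ Φ
  have hρ : ρ2 ≠ 0 := by rw [hρ2]; positivity
  have hΔ : Δ0 ≠ 0 := by rw [hΔ0]; positivity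
  have hsin : sin θ₀ ^ 2 = 1 - cos θ₀ ^ 2 := sin_sq θ₀
  have hsub : Δr = ΔrZ - 2 * m * r₀ := by rw [hΔr, hΔrZ]
  have radial : ρ2 / Δr = ρ2 / ΔrZ + 2 * m * r₀ * ρ2 / (ΔrZ * Δr) := by
    field_simp
    rw [hsub]
    ring
  have coeff_TT : -ΔrZ + sin θ₀ ^ 2 * Δθ * a ^ 2 =
      (Λ / 3 * (r₀ ^ 2 + a ^ 2 * sin θ₀ ^ 2) - 1) * ρ2 := by
    rw [hsin, hΔrZ, hΔθ, hρ2]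
    ring
  have coeff_TΦ : ΔrZ - Δθ * (r₀ ^ 2 + a ^ 2) = -(Λ / 3) * (r₀ ^ 2 + a ^ 2) * ρ2 := by
    rw [hΔrZ, hΔθ, hρ2]
    ring
  have coeff_ΦΦ : -ΔrZ * a ^ 2 * sin θ₀ ^ 2 + Δθ * (r₀ ^ 2 + a ^ 2) ^ 2 =
      (r₀ ^ 2 + a ^ 2) * Δ0 * ρ2 := by
    rw [hsin, hΔrZ, hΔθ, hΔ0, hρ2]
    ring
  have angular : -(ΔrZ / ρ2) * (T - a * sin θ₀ ^ 2 / Δ0 * Φ) ^ 2 +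
      sin θ₀ ^ 2 * (Δθ / ρ2) * (a * T - (r₀ ^ 2 + a ^ 2) / Δ0 * Φ) ^ 2 =
      (Λ / 3 * (r₀ ^ 2 + a ^ 2 * sin θ₀ ^ 2) - 1) * T ^ 2 -
        2 * Λ / 3 * a * ((r₀ ^ 2 + a ^ 2) / Δ0) * sin θ₀ ^ 2 * (T * Φ) +
        (r₀ ^ 2 + a ^ 2) / Δ0 * sin θ₀ ^ 2 * Φ ^ 2 := by
    field_simp
    linear_combination 3 * Δ0 ^ 2 * T ^ 2 * coeff_TT +
      6 * a * sin θ₀ ^ 2 * Δ0 * T * Φ * coeff_TΦ + 3 * sin θ₀ ^ 2 * Φ ^ 2 * coeff_ΦΦ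
  have split : Δr / ρ2 = ΔrZ / ρ2 - 2 * m * r₀ / ρ2 := by rw [hsub, sub_div]
  rw [radial, split]
  linear_combination angular
end
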